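/- arXiv:2312.06442 — 2 statements merged into one kernel-verified Lean document; each statement's English description precedes it below -/
import Mathlib

section
/- There are absolute constants c₁ and c₂ for which the following holds. Let X be an isotropic, log-concave random vector in ℝ^d and let X₁,…,X_m be independent copies of X. If A ⊂ S^{d−1} satisfies γ₁(A) ≥ 1, m ≥ γ₁(A), and Δ ≥ c₁ · (γ₁(A)/m) · log²(em/γ₁(A)), then with probability at least 1 − 2exp(−c₂ Δ m), sup_{x∈A} ‖F_{m,x} − F_x‖_{L∞} ≤ √Δ. -/
open MeasureTheory Real Set

noncomputable section

/-- The empirical distribution function of the sample `xs`. -/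
def empCDF {m : ℕ} (xs : Fin m → ℝ) (t : ℝ) : ℝ :=
  ((Finset.univ.filter fun i => xs i ≤ t).card : ℝ) / m

/-- The distribution function of `h(X)` where `X ∼ μ`. -/
def cdfOf {𝒳 : Type*} [MeasurableSpace 𝒳] (μ : Measure 𝒳) (h : 𝒳 → ℝ) (t : ℝ) : ℝ :=
  (μ {x | h x ≤ t}).toReal

/-- The L²(μ) distance between two functions. -/
def L2dist {𝒳 : Type*} [MeasurableSpace 𝒳] (μ : Measure 𝒳) (h g : 𝒳 → ℝ) : ℝ :=
  Real.sqrt (∫ x, (h x - g x) ^ 2 ∂μ)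

/-- An admissible sequence of subsets of `H`: `|T 0| = 1` and `|T s| ≤ 2^(2^s)` for `s ≥ 1`. -/
def IsAdmissible {E : Type*} (H : Set E) (T : ℕ → Set E) : Prop :=
  (∀ s, T s ⊆ H) ∧ (∀ s, (T s).Finite) ∧ (∀ s, (T s).Nonempty) ∧
    (T 0).ncard = 1 ∧ ∀ s, 1 ≤ s → (T s).ncard ≤ 2 ^ 2 ^ s

/-- Talagrand's γ₁ functional of `H` with respect to the distance `dist`:
the infimum over admissible sequences of `sup_{h ∈ H} ∑_s 2^s · dist(h, T s)`
(the sum of the nonnegative series being expressed through its partial sums). -/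
def gamma1 {E : Type*} (dist : E → E → ℝ) (H : Set E) : ℝ :=
  sInf { r : ℝ | ∃ T : ℕ → Set E, IsAdmissible H T ∧
    ∀ h ∈ H, ∀ n : ℕ, ∑ s ∈ Finset.range n, (2 : ℝ) ^ s * sInf (dist h '' T s) ≤ r }

/-- Generalized inverse of a distribution function. -/
def quantileFn (F : ℝ → ℝ) (u : ℝ) : ℝ := sInf {t | u ≤ F t}

/-- Assumption (A): every `h ∈ H` has mean zero and variance one; increments have
subexponential tails with constant `L`; and each `h(X)` has a density bounded by `D`. -/
def AssumptionA {𝒳 : Type*} [MeasurableSpace 𝒳] (μ : Measure 𝒳) (H : Set (𝒳 → ℝ))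
    (L D : ℝ) : Prop :=
  (∀ h ∈ H, Measurable h) ∧
  (∀ h ∈ H, ∫ x, h x ∂μ = 0) ∧
  (∀ h ∈ H, ∫ x, (h x) ^ 2 ∂μ = 1) ∧
  (∀ h ∈ insert 0 H, ∀ g ∈ insert 0 H, ∀ t : ℝ, 0 < t →
    μ {x | t * L * L2dist μ h g ≤ |h x - g x|} ≤ ENNReal.ofReal (2 * Real.exp (-t))) ∧
  (∀ h ∈ H, ∃ f : ℝ → ℝ, (∀ t, 0 ≤ f t ∧ f t ≤ D) ∧
    Measure.map h μ = (volume : Measure ℝ).withDensity fun t => ENNReal.ofReal (f t))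

/-- Euclidean distance on `Fin d → ℝ`. -/
def euclDist {d : ℕ} (x y : Fin d → ℝ) : ℝ := Real.sqrt (∑ i, (x i - y i) ^ 2)

/-- The Euclidean unit sphere in `Fin d → ℝ`. -/
def unitSphere (d : ℕ) : Set (Fin d → ℝ) := {x | ∑ i, (x i) ^ 2 = 1}

/-- The Euclidean inner product on `Fin d → ℝ`. -/
def dotp {d : ℕ} (v x : Fin d → ℝ) : ℝ := ∑ i, v i * x i

/-- A nonnegative density `f` on `Fin d → ℝ` is log-concave. -/
def IsLogConcave {d : ℕ} (f : (Fin d → ℝ) → ℝ) : Prop :=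
  ∀ v w : Fin d → ℝ, ∀ θ : ℝ, 0 ≤ θ → θ ≤ 1 →
    f v ^ θ * f w ^ (1 - θ) ≤ f (θ • v + (1 - θ) • w)

/-- One-dimensional Brunn–Minkowski inequality for compact sets, in midpoint form. -/
theorem volume_add_le_two_mul_of_isCompact {K₁ K₂ C : Set ℝ} (hK₁ : IsCompact K₁)
    (hK₂ : IsCompact K₂) (h₁ : K₁.Nonempty) (h₂ : K₂.Nonempty)
    (h : ∀ a ∈ K₁, ∀ b ∈ K₂, (a + b) / 2 ∈ C) :
    volume K₁ + volume K₂ ≤ 2 * volume C := by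
  obtain ⟨M, hM, hMub⟩ := hK₁.exists_isGreatest h₁
  obtain ⟨p, hp, hplb⟩ := hK₂.exists_isLeast h₂
  have hsub : ((fun x => x - p) ⁻¹' K₁) ∪ ((fun x => x - M) ⁻¹' K₂) ⊆
      (fun x => 2⁻¹ * x) ⁻¹' C := by
    rintro x (hx | hx)
    · have := h _ hx _ hp
      simp only [mem_preimage]
      convert this using 1
      ring
    · have := h _ hM _ hx
      simp only [mem_preimage]
      convert this using 1
      ring
  have hinter : ((fun x => x - p) ⁻¹' K₁) ∩ ((fun x => x - M) ⁻¹' K₂) ⊆ {M + p} := by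
    rintro x ⟨hx, hx'⟩
    have h1 : x - p ≤ M := hMub hx
    have h2 : p ≤ x - M := hplb hx'
    simp only [mem_singleton_iff]
    linarith
  have hm₂ : MeasurableSet ((fun x => x - M) ⁻¹' K₂) :=
    (measurable_id.sub_const M) hK₂.measurableSet
  have hunion := measure_union_add_inter (μ := (volume : Measure ℝ))
    ((fun x => x - p) ⁻¹' K₁) hm₂
  have hzero : volume (((fun x => x - p) ⁻¹' K₁) ∩ ((fun x => x - M) ⁻¹' K₂)) = 0 :=
    measure_mono_null hinter (by simp)
  have htrans : ∀ (q : ℝ) (K : Set ℝ), volume ((fun x => x - q) ⁻¹' K) = volume K := by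
    intro q K
    simp [sub_eq_add_neg]
  rw [hzero, add_zero, htrans, htrans] at hunion
  rw [← hunion]
  refine (measure_mono hsub).trans ?_
  rw [Real.volume_preimage_mul_left (by norm_num)]
  simp

/-- One-dimensional Brunn–Minkowski inequality for measurable sets, in midpoint form. -/
theorem volume_add_le_two_mul {A B C : Set ℝ} (hA : MeasurableSet A) (hB : MeasurableSet B)
    (hA' : A.Nonempty) (hB' : B.Nonempty) (h : ∀ a ∈ A, ∀ b ∈ B, (a + b) / 2 ∈ C) :
    volume A + volume B ≤ 2 * volume C := by
  obtain ⟨a₀, ha₀⟩ := hA'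
  obtain ⟨b₀, hb₀⟩ := hB'
  have hsup : ∀ S : Set ℝ, MeasurableSet S →
      volume S = ⨆ K, ⨆ (_ : K ⊆ S ∧ IsCompact K), volume K := by
    intro S hS
    rw [hS.measure_eq_iSup_isCompact]
    simp_rw [iSup_and]
  rw [hsup A hA, hsup B hB]
  refine ENNReal.biSup_add_biSup_le' (p := fun K => K ⊆ A ∧ IsCompact K)
    (q := fun K => K ⊆ B ∧ IsCompact K) ⟨∅, empty_subset _, isCompact_empty⟩
    ⟨∅, empty_subset _, isCompact_empty⟩ fun K₁ hK₁ K₂ hK₂ => ?_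
  refine le_trans (add_le_add (measure_mono (subset_insert a₀ K₁))
    (measure_mono (subset_insert b₀ K₂))) ?_
  refine volume_add_le_two_mul_of_isCompact (hK₁.2.insert a₀) (hK₂.2.insert b₀)
    (insert_nonempty _ _) (insert_nonempty _ _) fun a ha b hb => ?_
  exact h a (insert_subset ha₀ hK₁.1 ha) b (insert_subset hb₀ hK₂.1 hb)

theorem ENNReal.four_mul_le_add_sq (x y : ENNReal) : 4 * (x * y) ≤ (x + y) ^ 2 := by
  by_cases hx : x = ⊤
  · simp [hx]
  by_cases hy : y = ⊤
  · simp [hy]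
  lift x to NNReal using hx
  lift y to NNReal using hy
  norm_cast
  rw [← NNReal.coe_le_coe]
  push_cast
  nlinarith [sq_nonneg ((x : ℝ) - y)]

/-- One-dimensional Prékopa–Leindler inequality for normalized functions, in additive form. -/
theorem lintegral_add_le_two_mul_of_normalized {f g h : ℝ → ENNReal} (hf : Measurable f)
    (hg : Measurable g) (hh : Measurable h) (hf1 : ∀ x, f x ≤ 1) (hg1 : ∀ x, g x ≤ 1)
    (hfs : ∀ t < 1, ∃ x, t < f x) (hgs : ∀ t < 1, ∃ x, t < g x)
    (H : ∀ x y, f x * g y ≤ h ((x + y) / 2) ^ 2) :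
    (∫⁻ x, f x) + (∫⁻ x, g x) ≤ 2 * ∫⁻ x, h x := by
  have layer : ∀ k : ℝ → ENNReal, Measurable k → (∀ x, k x ≤ 1) →
      ∫⁻ x, k x = ∫⁻ t in Ioo (0 : ℝ) 1, volume {x | ENNReal.ofReal t < k x} := by
    intro k hk hk1
    have hfin : ∀ x, k x ≠ ⊤ := fun x => ((hk1 x).trans_lt ENNReal.one_lt_top).ne
    have h1 : ∫⁻ x, k x = ∫⁻ x, ENNReal.ofReal ((k x).toReal) :=
      lintegral_congr fun x => (ENNReal.ofReal_toReal (hfin x)).symm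
    rw [h1, lintegral_eq_lintegral_meas_lt volume (ae_of_all _ fun x => ENNReal.toReal_nonneg)
      hk.ennreal_toReal.aemeasurable, ← lintegral_indicator measurableSet_Ioi,
      ← lintegral_indicator measurableSet_Ioo]
    refine lintegral_congr fun t => ?_
    by_cases ht : t ∈ Ioo (0 : ℝ) 1
    · rw [indicator_of_mem ht, indicator_of_mem (mem_Ioi.2 ht.1)]
      congr 1
      ext x
      exact (ENNReal.ofReal_lt_iff_lt_toReal ht.1.le (hfin x)).symm
    · rw [indicator_of_notMem ht]
      by_cases ht0 : 0 < t
      · have ht1 : 1 ≤ t := by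
          by_contra hcon
          exact ht ⟨ht0, not_le.1 hcon⟩
        rw [indicator_of_mem (mem_Ioi.2 ht0)]
        convert measure_empty (μ := (volume : Measure ℝ))
        ext x
        simp only [mem_ofPred_eq, mem_empty_iff_false, iff_false, not_lt]
        exact (ENNReal.toReal_mono ENNReal.one_ne_top (hk1 x)).trans (by simpa using ht1)
      · rw [indicator_of_notMem (by simpa using ht0)]
  have hmin : ∫⁻ x, min (h x) 1 ≤ ∫⁻ x, h x := lintegral_mono fun x => min_le_left _ _
  refine le_trans ?_ (mul_le_mul_right hmin 2)
  rw [layer f hf hf1, layer g hg hg1, layer _ (hh.min measurable_const) fun x => min_le_right _ _,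
    ← lintegral_const_mul' _ _ (by norm_num)]
  have hmeas : ∀ k : ℝ → ENNReal,
      Measurable fun t : ℝ => volume {x | ENNReal.ofReal t < k x} := by
    intro k
    refine Antitone.measurable fun s t hst => measure_mono fun x hx => ?_
    exact (ENNReal.ofReal_le_ofReal hst).trans_lt hx
  rw [← lintegral_add_left (hmeas f)]
  refine setLIntegral_mono' measurableSet_Ioo fun t ht => ?_
  have ht1 : ENNReal.ofReal t < 1 := by simpa using ht.2
  refine volume_add_le_two_mul (measurableSet_lt measurable_const hf)
    (measurableSet_lt measurable_const hg) (hfs _ ht1) (hgs _ ht1) fun a ha b hb => ?_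
  simp only [mem_ofPred_eq] at ha hb ⊢
  refine lt_min ?_ ht1
  by_contra hcon
  push Not at hcon
  have h1 := H a b
  have h2 : ENNReal.ofReal t * ENNReal.ofReal t < f a * g b := ENNReal.mul_lt_mul ha hb
  refine absurd (h2.trans_le h1) (not_lt.2 ?_)
  rw [sq]
  exact mul_le_mul' hcon hcon

theorem exists_lt_of_normalized (f : ℝ → ENNReal) (h0 : (⨆ x, f x) ≠ 0)
    (htop : (⨆ x, f x) ≠ ⊤) (t : ENNReal) (ht : t < 1) : ∃ x, t < (⨆ x, f x)⁻¹ * f x := by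
  by_contra! hcon
  have h1 : (⨆ x, f x) ≤ (⨆ x, f x) * t := by
    refine iSup_le fun x => ?_
    calc f x = (⨆ x, f x) * ((⨆ x, f x)⁻¹ * f x) := by
          rw [← mul_assoc, ENNReal.mul_inv_cancel h0 htop, one_mul]
      _ ≤ _ := mul_le_mul_right (hcon x) _
  refine absurd h1 (not_le.2 ?_)
  calc (⨆ x, f x) * t < (⨆ x, f x) * 1 := (ENNReal.mul_lt_mul_iff_right h0 htop).2 ht
    _ = _ := mul_one _

/-- One-dimensional Prékopa–Leindler inequality at the midpoint. -/
theorem lintegral_mul_le_sq_real {f g h : ℝ → ENNReal} (hf : Measurable f)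
    (hg : Measurable g) (hh : Measurable h)
    (H : ∀ x y, f x * g y ≤ h ((x + y) / 2) ^ 2) :
    (∫⁻ x, f x) * (∫⁻ x, g x) ≤ (∫⁻ x, h x) ^ 2 := by
  have bdd : ∀ f g : ℝ → ENNReal, Measurable f → Measurable g →
      (∃ M : ENNReal, M ≠ ⊤ ∧ ∀ x, f x ≤ M) → (∃ M : ENNReal, M ≠ ⊤ ∧ ∀ x, g x ≤ M) →
      (∀ x y, f x * g y ≤ h ((x + y) / 2) ^ 2) →
      (∫⁻ x, f x) * (∫⁻ x, g x) ≤ (∫⁻ x, h x) ^ 2 := by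
    intro f g hf hg ⟨M, hM, hfM⟩ ⟨M', hM', hgM⟩ H
    set a := ⨆ x, f x with ha
    set b := ⨆ x, g x with hb
    have ha_top : a ≠ ⊤ := ((iSup_le hfM).trans_lt hM.lt_top).ne
    have hb_top : b ≠ ⊤ := ((iSup_le hgM).trans_lt hM'.lt_top).ne
    by_cases ha0 : a = 0
    · have : ∀ x, f x = 0 := fun x => le_zero_iff.1 (ha0 ▸ le_iSup f x)
      simp [this]
    by_cases hb0 : b = 0
    · have : ∀ x, g x = 0 := fun x => le_zero_iff.1 (hb0 ▸ le_iSup g x)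
      simp [this]
    set c := (a * b) ^ (1 / 2 : ℝ) with hc
    have hcc : c ^ 2 = a * b := by
      rw [hc, ← ENNReal.rpow_natCast, ← ENNReal.rpow_mul]
      norm_num
    have hab_top : a * b ≠ ⊤ := ENNReal.mul_ne_top ha_top hb_top
    have hab0 : a * b ≠ 0 := mul_ne_zero ha0 hb0
    have hinv : a⁻¹ * b⁻¹ = c⁻¹ ^ 2 := by
      rw [← ENNReal.inv_pow, hcc, ENNReal.mul_inv (Or.inl ha0) (Or.inl ha_top)]
    have key := lintegral_add_le_two_mul_of_normalized (hf.const_mul a⁻¹) (hg.const_mul b⁻¹)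
      (hh.const_mul c⁻¹) (fun x => ?_) (fun x => ?_) (fun t ht => ?_) (fun t ht => ?_) fun x y => ?_
    · rw [lintegral_const_mul _ hf, lintegral_const_mul _ hg, lintegral_const_mul _ hh] at key
      have h4 := (ENNReal.four_mul_le_add_sq (a⁻¹ * ∫⁻ x, f x) (b⁻¹ * ∫⁻ x, g x)).trans
        (pow_le_pow_left' key 2)
      have e1 : 4 * (a⁻¹ * (∫⁻ x, f x) * (b⁻¹ * ∫⁻ x, g x)) =
          (4 * c⁻¹ ^ 2) * ((∫⁻ x, f x) * ∫⁻ x, g x) := by rw [← hinv]; ring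
      have e2 : (2 * (c⁻¹ * ∫⁻ x, h x)) ^ 2 = (4 * c⁻¹ ^ 2) * (∫⁻ x, h x) ^ 2 := by ring
      rw [e1, e2] at h4
      refine (ENNReal.mul_le_mul_iff_right ?_ ?_).1 h4
      · rw [← hinv]
        simp [ha_top, hb_top]
      · rw [← hinv]
        exact ENNReal.mul_ne_top (by norm_num)
          (ENNReal.mul_ne_top (ENNReal.inv_ne_top.2 ha0) (ENNReal.inv_ne_top.2 hb0))
    · rw [← ENNReal.inv_mul_cancel ha0 ha_top]
      exact mul_le_mul_right (le_iSup f x) _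
    · rw [← ENNReal.inv_mul_cancel hb0 hb_top]
      exact mul_le_mul_right (le_iSup g x) _
    · exact exists_lt_of_normalized f ha0 ha_top t ht
    · exact exists_lt_of_normalized g hb0 hb_top t ht
    · have := mul_le_mul_right (H x y) (a⁻¹ * b⁻¹)
      calc _ = a⁻¹ * b⁻¹ * (f x * g y) := by ring
        _ ≤ _ := this
        _ = _ := by rw [hinv]; ring
  have hmono : ∀ f : ℝ → ENNReal, Measurable f →
      ∫⁻ x, f x = ⨆ n : ℕ, ∫⁻ x, min (f x) n := by
    intro f hf
    rw [← lintegral_iSup (fun n => hf.min measurable_const)]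
    · refine lintegral_congr fun x => ?_
      rw [← inf_iSup_eq, ENNReal.iSup_natCast]
      simp
    · intro m n hmn x
      exact min_le_min le_rfl (by exact_mod_cast hmn)
  rw [hmono f hf, hmono g hg, ENNReal.iSup_mul]
  refine iSup_le fun n => ?_
  rw [ENNReal.mul_iSup]
  refine iSup_le fun m => ?_
  refine bdd _ _ (hf.min measurable_const) (hg.min measurable_const)
    ⟨n, by simp, fun x => min_le_right _ _⟩ ⟨m, by simp, fun x => min_le_right _ _⟩ fun x y => ?_
  exact (mul_le_mul' (min_le_left _ _) (min_le_left _ _)).trans (H x y)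

theorem piFinSuccAbove_symm_eq_cons {n : ℕ} (p : ℝ × (Fin n → ℝ)) :
    (MeasurableEquiv.piFinSuccAbove (fun _ : Fin (n + 1) => ℝ) 0).symm p =
      (Fin.cons p.1 p.2 : Fin (n + 1) → ℝ) := by
  simp [MeasurableEquiv.piFinSuccAbove, Fin.insertNthEquiv]

theorem lintegral_fin_succ {n : ℕ} {f : (Fin (n + 1) → ℝ) → ENNReal} (hf : Measurable f) :
    ∫⁻ v, f v = ∫⁻ t : ℝ, ∫⁻ w : Fin n → ℝ, f (Fin.cons t w) := by
  have hmp := (volume_preserving_piFinSuccAbove (fun _ : Fin (n + 1) => ℝ) 0).symm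
  rw [← hmp.lintegral_comp hf, Measure.volume_eq_prod, lintegral_prod]
  · simp_rw [piFinSuccAbove_symm_eq_cons]
  · exact (hf.comp (MeasurableEquiv.measurable _)).aemeasurable

theorem measurable_finCons {n : ℕ} :
    Measurable fun p : ℝ × (Fin n → ℝ) => (Fin.cons p.1 p.2 : Fin (n + 1) → ℝ) := by
  simpa only [← piFinSuccAbove_symm_eq_cons] using
    (MeasurableEquiv.piFinSuccAbove (fun _ : Fin (n + 1) => ℝ) 0).symm.measurable

/-- Prékopa–Leindler inequality at the midpoint. -/
theorem lintegral_mul_le_sq {n : ℕ} {f g h : (Fin n → ℝ) → ENNReal} (hf : Measurable f)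
    (hg : Measurable g) (hh : Measurable h)
    (H : ∀ x y, f x * g y ≤ h ((1 / 2 : ℝ) • (x + y)) ^ 2) :
    (∫⁻ x, f x) * (∫⁻ x, g x) ≤ (∫⁻ x, h x) ^ 2 := by
  induction n with
  | zero =>
    have e : ∀ k : (Fin 0 → ℝ) → ENNReal, ∫⁻ x, k x = k 0 := by
      intro k
      rw [lintegral_unique]
      simp only [volume_pi, Measure.pi_univ, Finset.univ_eq_empty, Finset.prod_empty, mul_one]
      exact congrArg k (Subsingleton.elim _ _)
    rw [e, e, e]
    simpa using H 0 0
  | succ n ih =>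
    rw [lintegral_fin_succ hf, lintegral_fin_succ hg, lintegral_fin_succ hh]
    refine lintegral_mul_le_sq_real (hf.comp measurable_finCons).lintegral_prod_right'
      (hg.comp measurable_finCons).lintegral_prod_right'
      (hh.comp measurable_finCons).lintegral_prod_right' fun s t => ?_
    have hsec : ∀ r : ℝ, Measurable fun w : Fin n → ℝ => (Fin.cons r w : Fin (n + 1) → ℝ) :=
      fun r => measurable_finCons.comp (measurable_const.prodMk measurable_id)
    refine ih (hf.comp (hsec s)) (hg.comp (hsec t)) (hh.comp (hsec _)) fun x y => ?_
    convert H (Fin.cons s x) (Fin.cons t y) using 3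
    ext i
    refine Fin.cases ?_ (fun j => ?_) i
    · simp
      ring
    · simp
      ring

theorem IsLogConcave.convex_support {d : ℕ} {f : (Fin d → ℝ) → ℝ}
    (hf : IsLogConcave f) : Convex ℝ {v | 0 < f v} := by
  intro v hv w hw a b ha hb hab
  obtain rfl : b = 1 - a := by linarith
  have := hf v w a ha (by linarith)
  exact lt_of_lt_of_le (mul_pos (rpow_pos_of_pos hv _) (rpow_pos_of_pos hw _)) this

theorem IsLogConcave.concaveOn_log {d : ℕ} {f : (Fin d → ℝ) → ℝ} (hf : IsLogConcave f) :
    ConcaveOn ℝ {v | 0 < f v} fun v => Real.log (f v) := by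
  refine ⟨hf.convex_support, fun v hv w hw a b ha hb hab => ?_⟩
  obtain rfl : b = 1 - a := by linarith
  have h := hf v w a ha (by linarith)
  have hv' := rpow_pos_of_pos hv a
  have hw' := rpow_pos_of_pos hw (1 - a)
  have := Real.log_le_log (mul_pos hv' hw') h
  rwa [Real.log_mul hv'.ne' hw'.ne', Real.log_rpow hv, Real.log_rpow hw] at this

theorem IsLogConcave.continuousOn {d : ℕ} {f : (Fin d → ℝ) → ℝ} (hf : IsLogConcave f) :
    ContinuousOn f (interior {v | 0 < f v}) := by
  have h1 : ContinuousOn (fun v => Real.log (f v)) (interior {v | 0 < f v}) :=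
    (hf.concaveOn_log.subset interior_subset hf.convex_support.interior).continuousOn
      isOpen_interior
  refine (Real.continuous_exp.comp_continuousOn h1).congr fun v hv => ?_
  have hv' : v ∈ {v | 0 < f v} := interior_subset hv
  exact (Real.exp_log hv').symm

/-- A log-concave measure satisfies the Brunn–Minkowski-type inequality at the midpoint. -/
theorem IsLogConcave.measure_mul_le_sq {d : ℕ} {μ : Measure (Fin d → ℝ)}
    {f : (Fin d → ℝ) → ℝ} (hf0 : ∀ v, 0 ≤ f v) (hf : IsLogConcave f)
    (hμ : μ = (volume : Measure (Fin d → ℝ)).withDensity fun v => ENNReal.ofReal (f v))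
    {U V W : Set (Fin d → ℝ)} (hU : MeasurableSet U) (hV : MeasurableSet V)
    (hW : MeasurableSet W) (H : ∀ u ∈ U, ∀ v ∈ V, (1 / 2 : ℝ) • (u + v) ∈ W) :
    μ U * μ V ≤ μ W ^ 2 := by
  set S := {v | 0 < f v} with hS
  have hI : MeasurableSet (interior S) := isOpen_interior.measurableSet
  set g : (Fin d → ℝ) → ENNReal := (interior S).indicator fun v => ENNReal.ofReal (f v) with hg
  have hgm : Measurable g := by
    classical
    have h0 : Measurable ((interior S).indicator f) := by
      have := (hf.continuousOn.measurable_piecewise (g := fun _ => (0 : ℝ))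
        (continuous_const.continuousOn) hI)
      rw [← piecewise_eq_indicator]
      exact this
    convert h0.ennreal_ofReal using 1
    ext v
    by_cases hv : v ∈ interior S <;> simp [hg, hv]
  have hae : (fun v => ENNReal.ofReal (f v)) =ᵐ[volume] g := by
    have hfr : ∀ᵐ v ∂(volume : Measure (Fin d → ℝ)), v ∉ frontier S :=
      measure_eq_zero_iff_ae_notMem.1 (hf.convex_support.addHaar_frontier volume)
    filter_upwards [hfr] with v hv
    by_cases hvi : v ∈ interior S
    · simp [hg, hvi]
    · have hvS : v ∉ S := fun h => hv ⟨subset_closure h, hvi⟩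
      have : f v = 0 := le_antisymm (not_lt.1 hvS) (hf0 v)
      simp [hg, hvi, this]
  have hμU : ∀ U, MeasurableSet U → μ U = ∫⁻ v, U.indicator g v := by
    intro U hU
    rw [hμ, withDensity_congr_ae hae, withDensity_apply _ hU, lintegral_indicator hU]
  rw [hμU U hU, hμU V hV, hμU W hW]
  refine lintegral_mul_le_sq (hgm.indicator hU) (hgm.indicator hV) (hgm.indicator hW) fun x y => ?_
  by_cases hx : x ∈ U; swap
  · simp [hx]
  by_cases hy : y ∈ V; swap
  · simp [hy]
  by_cases hxi : x ∈ interior S; swap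
  · simp [hg, hxi, hx]
  by_cases hyi : y ∈ interior S; swap
  · simp [hg, hyi, hy]
  have hmid : (1 / 2 : ℝ) • (x + y) ∈ interior S := by
    rw [smul_add]
    exact hf.convex_support.interior hxi hyi (by norm_num) (by norm_num) (by norm_num)
  have hxS : x ∈ S := interior_subset hxi
  have hyS : y ∈ S := interior_subset hyi
  have hfx : 0 < f x := hxS
  have hfy : 0 < f y := hyS
  rw [indicator_of_mem hx, indicator_of_mem hy, indicator_of_mem (H x hx y hy), hg,
    indicator_of_mem hxi, indicator_of_mem hyi, indicator_of_mem hmid,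
    ← ENNReal.ofReal_mul (hf0 x), ← ENNReal.ofReal_pow (hf0 _)]
  refine ENNReal.ofReal_le_ofReal ?_
  have h := hf x y (1 / 2) (by norm_num) (by norm_num)
  have e : (1 / 2 : ℝ) • x + (1 - 1 / 2 : ℝ) • y = (1 / 2 : ℝ) • (x + y) := by
    rw [smul_add]; norm_num
  rw [e] at h
  have h2 := pow_le_pow_left₀ (mul_nonneg (rpow_nonneg hfx.le _) (rpow_nonneg hfy.le _)) h 2
  refine le_trans (le_of_eq ?_) h2
  rw [mul_pow, ← Real.rpow_natCast, ← Real.rpow_natCast, ← Real.rpow_mul hfx.le,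
    ← Real.rpow_mul hfy.le]
  norm_num

/-- A measure on the line satisfying the Brunn–Minkowski-type inequality at the midpoint. -/
def MidpointLogConcave (ν : Measure ℝ) : Prop :=
  ∀ U V W : Set ℝ, MeasurableSet U → MeasurableSet V → MeasurableSet W →
    (∀ u ∈ U, ∀ v ∈ V, (u + v) / 2 ∈ W) → ν U * ν V ≤ ν W ^ 2

theorem MidpointLogConcave.map_neg {ν : Measure ℝ} (hν : MidpointLogConcave ν) :
    MidpointLogConcave (ν.map fun y => -y) := by
  intro U V W hU hV hW H
  rw [Measure.map_apply measurable_neg hU, Measure.map_apply measurable_neg hV,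
    Measure.map_apply measurable_neg hW]
  refine hν _ _ _ (measurable_neg hU) (measurable_neg hV) (measurable_neg hW) fun u hu v hv => ?_
  have := H _ hu _ hv
  simp only [mem_preimage]
  convert this using 1
  ring

theorem MidpointLogConcave.measureReal_Ici_mul_le {ν : Measure ℝ} [IsProbabilityMeasure ν]
    (hν : MidpointLogConcave ν) (a b : ℝ) :
    ν.real (Ici a) * ν.real (Ici b) ≤ ν.real (Ici ((a + b) / 2)) ^ 2 := by
  have h := hν (Ici a) (Ici b) (Ici ((a + b) / 2)) measurableSet_Ici measurableSet_Ici
    measurableSet_Ici fun u hu v hv => by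
      simp only [mem_Ici] at *
      linarith
  simpa [Measure.real, ENNReal.toReal_mul] using
    ENNReal.toReal_mono (by finiteness) h

/-- A log-concave sequence whose first ratio is at most `ρ` decays geometrically. -/
theorem le_pow_mul_of_logConcave {q : ℕ → ℝ} {ρ : ℝ} (hq0 : ∀ k, 0 ≤ q k)
    (hanti : ∀ k, q (k + 1) ≤ q k) (hq : ∀ k, q k * q (k + 2) ≤ q (k + 1) ^ 2) (hρ : 0 ≤ ρ)
    (h1 : q 1 ≤ ρ * q 0) (k : ℕ) : q k ≤ ρ ^ k * q 0 := by
  have step : ∀ k, q (k + 1) ≤ ρ * q k := by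
    intro k
    induction k with
    | zero => exact h1
    | succ k ih =>
      rcases (hq0 k).eq_or_lt with h0 | hpos
      · have h2 : q (k + 1) = 0 := le_antisymm ((hanti k).trans h0.ge) (hq0 _)
        have h3 : q (k + 1 + 1) ≤ 0 := h2 ▸ hanti (k + 1)
        rw [h2]
        linarith
      · refine le_of_mul_le_mul_left ?_ hpos
        calc q k * q (k + 1 + 1) ≤ q (k + 1) ^ 2 := hq k
          _ = q (k + 1) * q (k + 1) := sq _
          _ ≤ (ρ * q k) * q (k + 1) := mul_le_mul_of_nonneg_right ih (hq0 _)
          _ = _ := by ring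
  induction k with
  | zero => simp
  | succ k ih =>
    calc q (k + 1) ≤ ρ * q k := step k
      _ ≤ ρ * (ρ ^ k * q 0) := mul_le_mul_of_nonneg_left ih hρ
      _ = _ := by ring

theorem MidpointLogConcave.measureReal_Ici_le {ν : Measure ℝ} [IsProbabilityMeasure ν]
    (hν : MidpointLogConcave ν) (a h : ℝ) (hh : 0 ≤ h) {ρ : ℝ} (hρ : 0 ≤ ρ)
    (h1 : ν.real (Ici (a + h)) ≤ ρ * ν.real (Ici a)) (k : ℕ) :
    ν.real (Ici (a + k * h)) ≤ ρ ^ k * ν.real (Ici a) := by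
  have := le_pow_mul_of_logConcave (q := fun k : ℕ => ν.real (Ici (a + k * h))) (ρ := ρ)
    (fun k => measureReal_nonneg) (fun k => measureReal_mono (Ici_subset_Ici.2 ?_))
    (fun k => ?_) hρ (by simpa using h1) k
  · simpa using this
  · push_cast
    nlinarith
  · refine (hν.measureReal_Ici_mul_le _ _).trans (le_of_eq ?_)
    congr 3
    push_cast
    ring

/-- Tail bound for a log-concave measure with second moment one. -/
theorem MidpointLogConcave.tail {ν : Measure ℝ} [IsProbabilityMeasure ν]
    (hν : MidpointLogConcave ν) (hint : Integrable (fun y : ℝ => y ^ 2) ν)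
    (h2 : ∫ y, y ^ 2 ∂ν = 1) (k : ℕ) : ν.real (Ici (-2 + k * 4)) ≤ (1 / 3) ^ k := by
  have hcheb : ν.real {y : ℝ | 4 ≤ y ^ 2} ≤ 1 / 4 := by
    have := mul_meas_ge_le_integral_of_nonneg (μ := ν) (f := fun y : ℝ => y ^ 2)
      (ae_of_all _ fun y => sq_nonneg y) hint 4
    rw [h2] at this
    linarith
  have hq1 : ν.real (Ici (-2 + 4)) ≤ 1 / 4 := by
    refine (measureReal_mono fun y hy => ?_).trans hcheb
    simp only [mem_Ici, mem_ofPred_eq] at *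
    nlinarith
  have hq0 : 3 / 4 ≤ ν.real (Ici (-2)) := by
    have h3 : ν.real (Ici (-2 : ℝ))ᶜ ≤ 1 / 4 := by
      refine (measureReal_mono fun y hy => ?_).trans hcheb
      simp only [mem_compl_iff, mem_Ici, mem_ofPred_eq, not_le] at *
      nlinarith
    rw [probReal_compl_eq_one_sub measurableSet_Ici] at h3
    linarith
  refine (hν.measureReal_Ici_le (-2) 4 (by norm_num) (ρ := 1 / 3) (by norm_num) (by linarith)
    k).trans ?_
  exact mul_le_of_le_one_right (by positivity) measureReal_le_one

theorem integrable_sq_map_neg {ν : Measure ℝ} (hint : Integrable (fun y : ℝ => y ^ 2) ν) :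
    Integrable (fun y : ℝ => y ^ 2) (ν.map fun y => -y) := by
  rw [integrable_map_measure (by fun_prop) measurable_neg.aemeasurable]
  simpa [Function.comp_def] using hint

theorem integral_sq_map_neg {ν : Measure ℝ} :
    ∫ y, y ^ 2 ∂(ν.map fun y => -y) = ∫ y, y ^ 2 ∂ν := by
  rw [integral_map measurable_neg.aemeasurable (by fun_prop)]
  simp

/-- A log-concave measure with second moment one has uniformly bounded exponential moments. -/
theorem MidpointLogConcave.lintegral_exp_le {ν : Measure ℝ} [IsProbabilityMeasure ν]
    (hν : MidpointLogConcave ν) (hint : Integrable (fun y : ℝ => y ^ 2) ν)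
    (h2 : ∫ y, y ^ 2 ∂ν = 1) :
    ∫⁻ y, ENNReal.ofReal (Real.exp (|y| / 8)) ∂ν ≤ ENNReal.ofReal 12 := by
  have hprob : IsProbabilityMeasure (ν.map fun y => -y) :=
    Measure.isProbabilityMeasure_map measurable_neg.aemeasurable
  have htail : ∀ k : ℕ, ν {y | -2 + k * 4 ≤ |y|} ≤ ENNReal.ofReal (2 * (1 / 3) ^ k) := by
    intro k
    have t1 := hν.tail hint h2 k
    have t2 := hν.map_neg.tail (integrable_sq_map_neg hint) (integral_sq_map_neg.trans h2) k
    rw [map_measureReal_apply measurable_neg measurableSet_Ici] at t2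
    have hsub : {y : ℝ | -2 + k * 4 ≤ |y|} ⊆
        Ici (-2 + k * 4 : ℝ) ∪ (fun y : ℝ => -y) ⁻¹' Ici (-2 + k * 4 : ℝ) := by
      intro y hy
      simp only [mem_ofPred_eq] at hy
      exact (le_abs.1 hy)
    rw [← ENNReal.toReal_le_toReal (by finiteness) (by finiteness),
      ENNReal.toReal_ofReal (by positivity)]
    exact (measureReal_mono hsub).trans ((measureReal_union_le _ _).trans (by linarith))
  have hpt : ∀ y : ℝ, ENNReal.ofReal (Real.exp (|y| / 8)) ≤
      ∑' k : ℕ, {y : ℝ | -2 + k * 4 ≤ |y|}.indicator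
        (fun _ => ENNReal.ofReal (Real.exp ((2 + k * 4) / 8))) y := by
    intro y
    set k := ⌊(|y| + 2) / 4⌋₊ with hk
    have hk1 : (k : ℝ) ≤ (|y| + 2) / 4 := Nat.floor_le (by positivity)
    have hk2 : (|y| + 2) / 4 < k + 1 := Nat.lt_floor_add_one _
    refine le_trans ?_ (ENNReal.le_tsum k)
    rw [indicator_of_mem (by simp only [mem_ofPred_eq]; linarith)]
    exact ENNReal.ofReal_le_ofReal (Real.exp_le_exp.2 (by linarith))
  have hmeas : ∀ k : ℕ, MeasurableSet {y : ℝ | -2 + k * 4 ≤ |y|} := fun k =>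
    measurableSet_le measurable_const (by fun_prop)
  refine (lintegral_mono hpt).trans ?_
  rw [lintegral_tsum fun k => (measurable_const.indicator (hmeas k)).aemeasurable]
  have hexp : Real.exp (1 / 2) ≤ 2 := by
    have h : Real.exp (1 / 2) ^ 2 = Real.exp 1 := by
      rw [← Real.exp_nat_mul]
      norm_num
    have := Real.exp_one_lt_d9
    have h0 := Real.exp_pos (1 / 2)
    nlinarith
  have hterm : ∀ k : ℕ, ∫⁻ y, {y : ℝ | -2 + k * 4 ≤ |y|}.indicator
      (fun _ => ENNReal.ofReal (Real.exp ((2 + k * 4) / 8))) y ∂ν ≤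
      ENNReal.ofReal (4 * (2 / 3) ^ k) := by
    intro k
    rw [lintegral_indicator_const (hmeas k)]
    refine (mul_le_mul_right (htail k) _).trans ?_
    rw [← ENNReal.ofReal_mul (Real.exp_pos _).le]
    refine ENNReal.ofReal_le_ofReal ?_
    have e1 : Real.exp ((2 + k * 4) / 8) ≤ 2 * 2 ^ k := by
      have : Real.exp ((2 + k * 4) / 8) ≤ Real.exp (1 / 2) * Real.exp (1 / 2) ^ k := by
        rw [← Real.exp_nat_mul, ← Real.exp_add]
        refine Real.exp_le_exp.2 ?_
        linarith
      refine this.trans ?_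
      gcongr
    calc _ ≤ (2 * 2 ^ k) * (2 * (1 / 3) ^ k : ℝ) := by gcongr
      _ = 4 * (2 / 3) ^ k := by
        rw [div_pow, div_pow]
        ring
  refine (ENNReal.tsum_le_tsum hterm).trans ?_
  have hs : HasSum (fun k : ℕ => 4 * (2 / 3 : ℝ) ^ k) 12 := by
    have := (hasSum_geometric_of_lt_one (r := (2 / 3 : ℝ)) (by norm_num) (by norm_num)).mul_left 4
    norm_num at this
    exact this
  rw [← ENNReal.ofReal_tsum_of_nonneg (fun k => by positivity) hs.summable, hs.tsum_eq]

theorem pow_four_le_exp (y : ℝ) : y ^ 4 ≤ 98304 * Real.exp (|y| / 8) := by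
  have h := Real.pow_div_factorial_le_exp (|y| / 8) (by positivity) 4
  have e : (|y| / 8) ^ 4 = y ^ 4 / 4096 := by
    rw [div_pow]
    congr 1
    · exact Even.pow_abs (by decide) y
    · norm_num
  rw [e] at h
  norm_num [Nat.factorial] at h
  linarith

theorem MidpointLogConcave.integrable_exp {ν : Measure ℝ} [IsProbabilityMeasure ν]
    (hν : MidpointLogConcave ν) (hint : Integrable (fun y : ℝ => y ^ 2) ν)
    (h2 : ∫ y, y ^ 2 ∂ν = 1) : Integrable (fun y => Real.exp (|y| / 8)) ν := by
  refine ⟨by fun_prop, ?_⟩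
  rw [hasFiniteIntegral_iff_ofReal (ae_of_all _ fun y => (Real.exp_pos _).le)]
  exact (hν.lintegral_exp_le hint h2).trans_lt ENNReal.ofReal_lt_top

theorem MidpointLogConcave.integrable_pow_four {ν : Measure ℝ} [IsProbabilityMeasure ν]
    (hν : MidpointLogConcave ν) (hint : Integrable (fun y : ℝ => y ^ 2) ν)
    (h2 : ∫ y, y ^ 2 ∂ν = 1) : Integrable (fun y : ℝ => y ^ 4) ν := by
  refine ((hν.integrable_exp hint h2).const_mul 98304).mono' (by fun_prop)
    (ae_of_all _ fun y => ?_)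
  rw [Real.norm_of_nonneg (by positivity)]
  exact pow_four_le_exp y

theorem MidpointLogConcave.integral_pow_four_le {ν : Measure ℝ} [IsProbabilityMeasure ν]
    (hν : MidpointLogConcave ν) (hint : Integrable (fun y : ℝ => y ^ 2) ν)
    (h2 : ∫ y, y ^ 2 ∂ν = 1) : ∫ y, y ^ 4 ∂ν ≤ 1179648 := by
  have h1 : ∫ y, Real.exp (|y| / 8) ∂ν ≤ 12 := by
    rw [integral_eq_lintegral_of_nonneg_ae (ae_of_all _ fun y => (Real.exp_pos _).le)
      (by fun_prop)]
    refine ENNReal.toReal_le_of_le_ofReal (by norm_num) (hν.lintegral_exp_le hint h2)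
  have h3 : ∫ y, y ^ 4 ∂ν ≤ ∫ y, 98304 * Real.exp (|y| / 8) ∂ν :=
    integral_mono (hν.integrable_pow_four hint h2) ((hν.integrable_exp hint h2).const_mul _)
      pow_four_le_exp
  rw [integral_const_mul] at h3
  linarith

/-- Paley–Zygmund type anti-concentration around every point. -/
theorem MidpointLogConcave.le_measureReal_far {ν : Measure ℝ} [IsProbabilityMeasure ν]
    (hν : MidpointLogConcave ν) (hint : Integrable (fun y : ℝ => y ^ 2) ν)
    (h2 : ∫ y, y ^ 2 ∂ν = 1) (h1 : ∫ y, y ∂ν = 0) (t : ℝ) :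
    1 / (32 * 1179648) ≤ ν.real {y : ℝ | 1 / 2 ≤ (y - t) ^ 2} := by
  set M : ℝ := 1179648 with hM
  have hint1 : Integrable (fun y : ℝ => y) ν := by
    refine (hint.add (integrable_const (1 : ℝ))).mono' (by fun_prop) (ae_of_all _ fun y => ?_)
    simp only [Real.norm_eq_abs, Pi.add_apply]
    rw [abs_le]
    constructor <;> nlinarith [sq_nonneg (y - 1), sq_nonneg (y + 1)]
  have hm4 := hν.integral_pow_four_le hint h2
  have hi4 := hν.integrable_pow_four hint h2
  set p := ν.real {y : ℝ | 1 / 2 ≤ (y - t) ^ 2} with hp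
  have hset : MeasurableSet {y : ℝ | 1 / 2 ≤ (y - t) ^ 2} :=
    measurableSet_le measurable_const (by fun_prop)
  set s : ℝ := 1 / (32 * M * (1 + t ^ 2)) with hs
  have hs0 : 0 < s := by positivity
  set I : ℝ → ℝ := {y : ℝ | 1 / 2 ≤ (y - t) ^ 2}.indicator (fun _ => 1) with hI
  have hpt : ∀ y : ℝ, y ^ 2 - 2 * t * y + t ^ 2 ≤
      1 / 2 + s * (8 * (y ^ 4 + t ^ 4)) + 1 / (4 * s) * I y := by
    intro y
    have e4 : (y - t) ^ 4 ≤ 8 * (y ^ 4 + t ^ 4) := by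
      nlinarith [sq_nonneg (y + t), sq_nonneg (y ^ 2 - t ^ 2), sq_nonneg (y - t),
        mul_nonneg (sq_nonneg (y + t)) (sq_nonneg (y + t)),
        mul_nonneg (sq_nonneg (y + t)) (sq_nonneg (y - t))]
    have hmul := mul_le_mul_of_nonneg_left e4 hs0.le
    have hpos : 0 ≤ s * (y - t) ^ 4 := by positivity
    by_cases hy : 1 / 2 ≤ (y - t) ^ 2
    · have hIy : I y = 1 := indicator_of_mem (s := {y : ℝ | 1 / 2 ≤ (y - t) ^ 2}) hy _
      rw [hIy]
      have key : (y - t) ^ 2 ≤ s * (y - t) ^ 4 + 1 / (4 * s) := by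
        have e : s * (y - t) ^ 4 + 1 / (4 * s) - (y - t) ^ 2 =
            (2 * s * (y - t) ^ 2 - 1) ^ 2 / (4 * s) := by
          field_simp
          ring
        have : 0 ≤ (2 * s * (y - t) ^ 2 - 1) ^ 2 / (4 * s) := by positivity
        linarith
      nlinarith
    · have hIy : I y = 0 := indicator_of_notMem (s := {y : ℝ | 1 / 2 ≤ (y - t) ^ 2}) hy _
      rw [hIy]
      nlinarith
  have hIint : Integrable I ν := (integrable_const (1 : ℝ)).indicator hset
  have i1 : Integrable (fun y : ℝ => y ^ 2 - 2 * t * y) ν := hint.sub (hint1.const_mul _)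
  have i4 : Integrable (fun y : ℝ => y ^ 4 + t ^ 4) ν := hi4.add (integrable_const _)
  have i3 : Integrable (fun y : ℝ => s * (8 * (y ^ 4 + t ^ 4))) ν :=
    (i4.const_mul 8).const_mul s
  have i2 : Integrable (fun y : ℝ => 1 / 2 + s * (8 * (y ^ 4 + t ^ 4))) ν :=
    (integrable_const _).add i3
  have i5 : Integrable (fun y : ℝ => 1 / (4 * s) * I y) ν := hIint.const_mul _
  have hmono := integral_mono (i1.add (integrable_const (t ^ 2))) (i2.add i5) hpt
  have hIval : ∫ y, I y ∂ν = p := by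
    rw [hI, integral_indicator_const _ hset]
    simp [hp]
  have eL : ∫ y, (y ^ 2 - 2 * t * y + t ^ 2) ∂ν = 1 + t ^ 2 := by
    rw [integral_add i1 (integrable_const _),
      integral_sub hint (hint1.const_mul _), integral_const_mul, h1, h2]
    simp
  have eR : ∫ y, (1 / 2 + s * (8 * (y ^ 4 + t ^ 4)) + 1 / (4 * s) * I y) ∂ν =
      1 / 2 + s * (8 * (∫ y, y ^ 4 ∂ν + t ^ 4)) + 1 / (4 * s) * p := by
    rw [integral_add i2 i5, integral_add (integrable_const _) i3,
      integral_const_mul, integral_const_mul, integral_add hi4 (integrable_const _),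
      integral_const_mul, hIval]
    simp
  have hfin : 1 + t ^ 2 ≤ 1 / 2 + s * (8 * (∫ y, y ^ 4 ∂ν + t ^ 4)) + 1 / (4 * s) * p := by
    rw [← eL, ← eR]
    exact hmono
  have hb : s * (8 * (∫ y, y ^ 4 ∂ν + t ^ 4)) ≤ (1 + t ^ 2) / 4 := by
    have : 8 * (∫ y, y ^ 4 ∂ν + t ^ 4) ≤ 8 * M * (1 + t ^ 2) ^ 2 := by
      rw [hM]
      nlinarith [sq_nonneg t, sq_nonneg (t ^ 2)]
    calc _ ≤ s * (8 * M * (1 + t ^ 2) ^ 2) := mul_le_mul_of_nonneg_left this hs0.le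
      _ = _ := by
        rw [hs]
        field_simp
        norm_num
  have hc : 1 / (4 * s) = 8 * M * (1 + t ^ 2) := by
    rw [hs]
    field_simp
    norm_num
  rw [hc] at hfin
  have hMpos : 0 < M := by norm_num [hM]
  rw [div_le_iff₀ (by positivity)]
  have ht : 0 < 1 + t ^ 2 := by positivity
  have : (1 + t ^ 2) * 1 ≤ (1 + t ^ 2) * (p * (32 * M)) := by nlinarith
  exact le_of_mul_le_mul_left this ht

theorem MidpointLogConcave.small_ball_aux {ν : Measure ℝ} [IsProbabilityMeasure ν]
    (hν : MidpointLogConcave ν) {c : ℝ} (hc : 0 < c) (hc1 : c ≤ 1) {t h : ℝ} (hh : 0 < h)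
    (hfar : c ≤ ν.real (Ici (t + 1 / 2))) : ν.real (Ico t (t + h)) ≤ 4 / c * h := by
  rcases lt_or_ge (1 / 2) h with hh2 | hh2
  · refine measureReal_le_one.trans ?_
    rw [div_mul_eq_mul_div, le_div_iff₀ hc]
    linarith
  set n := ⌊1 / (2 * h)⌋₊ with hn
  have hn1 : (n : ℝ) ≤ 1 / (2 * h) := Nat.floor_le (by positivity)
  have hn2 : 1 / (2 * h) < n + 1 := Nat.lt_floor_add_one _
  have hge : 1 ≤ 1 / (2 * h) := by rw [le_div_iff₀ (by positivity)]; linarith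
  have hn3 : 1 ≤ n := Nat.le_floor (by simpa using hge)
  have hn4 : (1 : ℝ) ≤ n := by exact_mod_cast hn3
  have hnh : n * h ≤ 1 / 2 := by
    rw [le_div_iff₀ (by positivity)] at hn1
    linarith
  set q0 := ν.real (Ici t) with hq0
  set q1 := ν.real (Ici (t + h)) with hq1
  have hc0 : c ≤ q0 := hfar.trans (measureReal_mono (Ici_subset_Ici.2 (by linarith)))
  have hq0p : 0 < q0 := hc.trans_le hc0
  have hq01 : q0 ≤ 1 := measureReal_le_one
  have hq10 : q1 ≤ q0 := measureReal_mono (Ici_subset_Ici.2 (by linarith))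
  set x := 1 - q1 / q0 with hx
  have hρ0 : 0 ≤ q1 / q0 := by positivity
  have hx0 : 0 ≤ x := by rw [hx, sub_nonneg, div_le_one hq0p]; exact hq10
  have hpow := hν.measureReal_Ici_le t h hh.le hρ0 (by rw [div_mul_cancel₀ _ hq0p.ne']) n
  have hcpow : c ≤ (1 - x) ^ n := by
    have h3 : c ≤ ν.real (Ici (t + n * h)) :=
      hfar.trans (measureReal_mono (Ici_subset_Ici.2 (by linarith)))
    have h4 : 1 - x = q1 / q0 := by rw [hx]; ring
    rw [h4]
    refine h3.trans (hpow.trans (mul_le_of_le_one_right (by positivity) hq01))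
  have hx1 : 0 ≤ 1 - x := by rw [hx]; simpa using hρ0
  have hbern : c * (1 + n * x) ≤ 1 := by
    calc c * (1 + n * x) ≤ (1 - x) ^ n * (1 + x) ^ n :=
          mul_le_mul hcpow (one_add_mul_le_pow (by linarith) n) (by positivity) (by positivity)
      _ = ((1 - x) * (1 + x)) ^ n := (mul_pow _ _ _).symm
      _ ≤ 1 := pow_le_one₀ (mul_nonneg hx1 (by linarith)) (by nlinarith)
  have hsplit : ν.real (Ico t (t + h)) = q0 - q1 := by
    rw [← Ici_sdiff_Ici, measureReal_sdiff (Ici_subset_Ici.2 (by linarith)) measurableSet_Ici]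
  have hxq : q0 - q1 ≤ x := by
    have e : q0 - q1 = q0 * x := by rw [hx]; field_simp
    rw [e]
    exact mul_le_of_le_one_left hx0 hq01
  rw [hsplit]
  refine hxq.trans ?_
  have h4 : 1 ≤ 4 * h * n := by
    rw [div_lt_iff₀ (by positivity)] at hn2
    nlinarith
  rw [div_mul_eq_mul_div, le_div_iff₀ hc]
  have h5 : c * x * n ≤ 1 := by nlinarith
  have h6 : 0 ≤ c * x := by positivity
  nlinarith

/-- An isotropic log-concave measure on the line has uniformly bounded small-ball constants. -/
theorem MidpointLogConcave.small_ball {ν : Measure ℝ} [IsProbabilityMeasure ν]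
    (hν : MidpointLogConcave ν) (hint : Integrable (fun y : ℝ => y ^ 2) ν)
    (h2 : ∫ y, y ^ 2 ∂ν = 1) (h1 : ∫ y, y ∂ν = 0) (t h : ℝ) (hh : 0 < h) :
    ν.real (Icc t (t + h)) ≤ 603979776 * h := by
  have hfar := hν.le_measureReal_far hint h2 h1 t
  set c : ℝ := 1 / (64 * 1179648) with hc
  have hprob : IsProbabilityMeasure (ν.map fun y => -y) :=
    Measure.isProbabilityMeasure_map measurable_neg.aemeasurable
  have hor : c ≤ ν.real (Ici (t + 1 / 2)) ∨ c ≤ ν.real (Iic (t - 1 / 2)) := by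
    by_contra! hcon
    have hsub : {y : ℝ | 1 / 2 ≤ (y - t) ^ 2} ⊆ Ici (t + 1 / 2) ∪ Iic (t - 1 / 2) := by
      intro y hy
      simp only [mem_ofPred_eq] at hy
      simp only [mem_union, mem_Ici, mem_Iic]
      by_contra! hlt
      nlinarith
    have := (measureReal_mono hsub).trans (measureReal_union_le (μ := ν) _ _)
    norm_num [hc] at *
    linarith
  rcases hor with hor | hor
  · have := hν.small_ball_aux (by norm_num [hc]) (by norm_num [hc]) (h := 2 * h) (by linarith) hor
    refine (measureReal_mono fun y hy => ?_).trans (this.trans (le_of_eq ?_))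
    · exact ⟨hy.1, by linarith [hy.2]⟩
    · rw [hc]
      ring
  · have := hν.map_neg.small_ball_aux (t := -t - h) (by norm_num [hc]) (by norm_num [hc])
      (h := 2 * h) (by linarith) (c := c) (by
        rw [map_measureReal_apply measurable_neg measurableSet_Ici]
        refine hor.trans (measureReal_mono fun y hy => ?_)
        simp only [mem_preimage, mem_Ici, mem_Iic] at *
        linarith)
    rw [map_measureReal_apply measurable_neg measurableSet_Ico] at this
    refine (measureReal_mono fun y hy => ?_).trans (this.trans (le_of_eq ?_))
    · simp only [mem_preimage, mem_Ico, mem_Icc] at *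
      constructor <;> linarith
    · rw [hc]
      ring

theorem measurable_dotp {d : ℕ} (u : Fin d → ℝ) : Measurable fun v => dotp v u := by
  unfold dotp
  fun_prop

theorem dotp_sub {d : ℕ} (v x y : Fin d → ℝ) : dotp v x - dotp v y = dotp v (x - y) := by
  simp [dotp, mul_sub, Finset.sum_sub_distrib]

theorem dotp_smul {d : ℕ} (v x : Fin d → ℝ) (c : ℝ) : dotp v (c • x) = c * dotp v x := by
  simp only [dotp, Finset.mul_sum, Pi.smul_apply, smul_eq_mul]
  exact Finset.sum_congr rfl fun i _ => by ring

theorem abs_dotp_sub_le {d : ℕ} (v x y : Fin d → ℝ) :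
    |dotp v x - dotp v y| ≤ √(∑ i, v i ^ 2) * euclDist x y := by
  rw [dotp_sub, euclDist]
  refine abs_le_of_sq_le_sq ?_ (by positivity)
  rw [mul_pow, sq_sqrt (by positivity), sq_sqrt (by positivity)]
  exact Finset.sum_mul_sq_le_sq_mul_sq _ _ _

theorem IsLogConcave.midpointLogConcave_map_dotp {d : ℕ} {μ : Measure (Fin d → ℝ)}
    {f : (Fin d → ℝ) → ℝ} (hf0 : ∀ v, 0 ≤ f v) (hf : IsLogConcave f)
    (hμ : μ = volume.withDensity fun v => ENNReal.ofReal (f v)) (u : Fin d → ℝ) :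
    MidpointLogConcave (μ.map fun v => dotp v u) := by
  intro U V W hU hV hW H
  have hm := measurable_dotp u
  rw [Measure.map_apply hm hU, Measure.map_apply hm hV, Measure.map_apply hm hW]
  refine IsLogConcave.measure_mul_le_sq hf0 hf hμ (hm hU) (hm hV) (hm hW) fun a ha b hb => ?_
  have key := H _ ha _ hb
  have e : dotp ((1 / 2 : ℝ) • (a + b)) u = (dotp a u + dotp b u) / 2 := by
    simp only [dotp, Pi.smul_apply, Pi.add_apply, smul_eq_mul]
    rw [← Finset.sum_add_distrib, Finset.sum_div]
    exact Finset.sum_congr rfl fun i _ => by ring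
  simpa only [mem_preimage, e] using key

section Isotropic

variable {d : ℕ} {μ : Measure (Fin d → ℝ)}

theorem integrable_coord_mul
    (hcov : ∀ i j, ∫ v, v i * v j ∂μ = if i = j then (1 : ℝ) else 0) (i j : Fin d) :
    Integrable (fun v : Fin d → ℝ => v i * v j) μ := by
  have hsq : ∀ i, Integrable (fun v : Fin d → ℝ => v i * v i) μ := fun i => by
    by_contra hcon
    have := hcov i i
    rw [integral_undef hcon] at this
    simp at this
  refine ((hsq i).add (hsq j)).mono' (by fun_prop) (ae_of_all _ fun v => ?_)
  simp only [Real.norm_eq_abs, Pi.add_apply]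
  rw [abs_le]
  constructor <;> nlinarith [sq_nonneg (v i - v j), sq_nonneg (v i + v j)]

theorem integrable_coord [IsProbabilityMeasure μ]
    (hcov : ∀ i j, ∫ v, v i * v j ∂μ = if i = j then (1 : ℝ) else 0) (i : Fin d) :
    Integrable (fun v : Fin d → ℝ => v i) μ := by
  refine ((integrable_coord_mul hcov i i).add (integrable_const (1 : ℝ))).mono'
    (measurable_pi_apply i).aestronglyMeasurable (ae_of_all _ fun v => ?_)
  simp only [Real.norm_eq_abs, Pi.add_apply]
  rw [abs_le]
  constructor <;> nlinarith [sq_nonneg (v i - 1), sq_nonneg (v i + 1)]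

theorem dotp_sq {d : ℕ} (v u : Fin d → ℝ) :
    dotp v u ^ 2 = ∑ i, ∑ j, u i * u j * (v i * v j) := by
  rw [sq, dotp, Finset.sum_mul_sum]
  exact Finset.sum_congr rfl fun i _ => Finset.sum_congr rfl fun j _ => by ring

theorem integrable_dotp_sq
    (hcov : ∀ i j, ∫ v, v i * v j ∂μ = if i = j then (1 : ℝ) else 0) (u : Fin d → ℝ) :
    Integrable (fun v => dotp v u ^ 2) μ := by
  simp only [dotp_sq]
  exact integrable_finsetSum _ fun i _ => integrable_finsetSum _ fun j _ =>
    (integrable_coord_mul hcov i j).const_mul _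

theorem integral_dotp_sq
    (hcov : ∀ i j, ∫ v, v i * v j ∂μ = if i = j then (1 : ℝ) else 0) (u : Fin d → ℝ) :
    ∫ v, dotp v u ^ 2 ∂μ = ∑ i, u i ^ 2 := by
  simp only [dotp_sq]
  rw [integral_finsetSum _ fun i _ => integrable_finsetSum _ fun j _ =>
    (integrable_coord_mul hcov i j).const_mul _]
  refine Finset.sum_congr rfl fun i _ => ?_
  rw [integral_finsetSum _ fun j _ => (integrable_coord_mul hcov i j).const_mul _]
  simp only [integral_const_mul, hcov]
  simp [sq]

theorem integral_dotp [IsProbabilityMeasure μ] (hmean : ∀ i, ∫ v, v i ∂μ = 0)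
    (hcov : ∀ i j, ∫ v, v i * v j ∂μ = if i = j then (1 : ℝ) else 0) (u : Fin d → ℝ) :
    ∫ v, dotp v u ∂μ = 0 := by
  simp only [dotp]
  rw [integral_finsetSum _ fun i _ => (integrable_coord hcov i).mul_const _]
  simp [integral_mul_const, hmean]

theorem IsLogConcave.small_ball [IsProbabilityMeasure μ] {f : (Fin d → ℝ) → ℝ} (hf0 : ∀ v, 0 ≤ f v)
    (hf : IsLogConcave f) (hμ : μ = volume.withDensity fun v => ENNReal.ofReal (f v))
    (hmean : ∀ i, ∫ v, v i ∂μ = 0)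
    (hcov : ∀ i j, ∫ v, v i * v j ∂μ = if i = j then (1 : ℝ) else 0)
    {x : Fin d → ℝ} (hx : x ∈ unitSphere d) (t h : ℝ) (hh : 0 < h) :
    μ.real {v | t ≤ dotp v x ∧ dotp v x ≤ t + h} ≤ 603979776 * h := by
  have hm := measurable_dotp x
  have hprob : IsProbabilityMeasure (μ.map fun v => dotp v x) :=
    Measure.isProbabilityMeasure_map hm.aemeasurable
  have hmap : Integrable (fun y : ℝ => y ^ 2) (μ.map fun v => dotp v x) := by
    rw [integrable_map_measure (by fun_prop) hm.aemeasurable]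
    exact integrable_dotp_sq hcov x
  have := (hf.midpointLogConcave_map_dotp hf0 hμ x).small_ball hmap
    (by
      rw [integral_map hm.aemeasurable (by fun_prop), integral_dotp_sq hcov]
      exact hx)
    (by
      rw [integral_map hm.aemeasurable (by fun_prop)]
      exact integral_dotp hmean hcov x) t h hh
  rwa [map_measureReal_apply hm measurableSet_Icc] at this

theorem IsLogConcave.lintegral_exp_dotp_le [IsProbabilityMeasure μ] {f : (Fin d → ℝ) → ℝ}
    (hf0 : ∀ v, 0 ≤ f v)
    (hf : IsLogConcave f) (hμ : μ = volume.withDensity fun v => ENNReal.ofReal (f v))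
    (hcov : ∀ i j, ∫ v, v i * v j ∂μ = if i = j then (1 : ℝ) else 0)
    {x y : Fin d → ℝ} (hxy : 0 < euclDist x y) :
    ∫⁻ v, ENNReal.ofReal (Real.exp (|dotp v x - dotp v y| / (8 * euclDist x y))) ∂μ ≤
      ENNReal.ofReal 12 := by
  set r := euclDist x y with hr
  set u : Fin d → ℝ := r⁻¹ • (x - y) with hu
  have hm := measurable_dotp u
  have hprob : IsProbabilityMeasure (μ.map fun v => dotp v u) :=
    Measure.isProbabilityMeasure_map hm.aemeasurable
  have hmap : Integrable (fun y : ℝ => y ^ 2) (μ.map fun v => dotp v u) := by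
    rw [integrable_map_measure (by fun_prop) hm.aemeasurable]
    exact integrable_dotp_sq hcov u
  have hr2 : r ^ 2 = ∑ i, (x i - y i) ^ 2 := by
    rw [hr, euclDist, sq_sqrt (by positivity)]
  have := (hf.midpointLogConcave_map_dotp hf0 hμ u).lintegral_exp_le hmap
    (by
      rw [integral_map hm.aemeasurable (by fun_prop), integral_dotp_sq hcov]
      simp only [hu, Pi.smul_apply, Pi.sub_apply, smul_eq_mul, mul_pow]
      rw [← Finset.mul_sum, ← hr2, inv_pow]
      exact inv_mul_cancel₀ (by positivity))
  rw [lintegral_map (by fun_prop) hm] at this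
  refine le_trans (le_of_eq (lintegral_congr fun v => ?_)) this
  congr 2
  rw [dotp_sub, hu, dotp_smul, abs_mul, abs_of_pos (inv_pos.2 hxy)]
  field_simp

end Isotropic

section Chernoff

variable {𝒳 : Type*} [MeasurableSpace 𝒳] {μ : Measure 𝒳} [IsProbabilityMeasure μ]

/-- The Chernoff bound for a sum of independent copies. -/
theorem pi_real_le_sum_le {m : ℕ} {g : 𝒳 → ℝ} {B : ℝ}
    (hint : Integrable (fun v => Real.exp (g v)) μ) (hB : ∫ v, Real.exp (g v) ∂μ ≤ Real.exp B)
    (τ : ℝ) :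
    (Measure.pi fun _ : Fin m => μ).real {ω | τ ≤ ∑ i, g (ω i)} ≤ Real.exp (m * B - τ) := by
  have hprod : ∀ ω : Fin m → 𝒳, ∏ i, Real.exp (g (ω i)) = Real.exp (∑ i, g (ω i)) :=
    fun ω => (Real.exp_sum _ _).symm
  have hI : Integrable (fun ω : Fin m → 𝒳 => Real.exp (∑ i, g (ω i)))
      (Measure.pi fun _ : Fin m => μ) := by
    simp only [← hprod]
    exact Integrable.fintype_prod (f := fun (_ : Fin m) v => Real.exp (g v)) (fun _ => hint)
  have hmk := mul_meas_ge_le_integral_of_nonneg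
    (ae_of_all _ fun ω : Fin m → 𝒳 => (Real.exp_pos (∑ i, g (ω i))).le) hI (Real.exp τ)
  simp only [Real.exp_le_exp] at hmk
  have hval : ∫ ω, Real.exp (∑ i, g (ω i)) ∂(Measure.pi fun _ : Fin m => μ) ≤
      Real.exp (m * B) := by
    simp only [← hprod]
    rw [integral_fintype_prod_eq_pow (ι := Fin m) (fun v => Real.exp (g v)), Fintype.card_fin,
      Real.exp_nat_mul]
    exact pow_le_pow_left₀ (integral_nonneg fun v => (Real.exp_pos _).le) hB _
  rw [Real.exp_sub, le_div_iff₀ (Real.exp_pos _), mul_comm]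
  exact hmk.trans hval

/-- A Bernstein-type deviation inequality (one-sided) for bounded functions with small support. -/
theorem pi_real_bernstein_upper {m : ℕ} {f : 𝒳 → ℝ} (hf : Measurable f) (hf1 : ∀ v, |f v| ≤ 1)
    {σ : ℝ} (hσ : μ.real {v | f v ≠ 0} ≤ σ) {l : ℝ} (hl0 : 0 < l) (hl1 : l ≤ 1) (τ : ℝ) :
    (Measure.pi fun _ : Fin m => μ).real {ω | τ ≤ ∑ i, f (ω i) - m * ∫ v, f v ∂μ} ≤
      Real.exp (l ^ 2 * σ * m - l * τ) := by
  have hset : MeasurableSet {v | f v ≠ 0} := (hf (measurableSet_singleton 0)).compl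
  have hfint : Integrable f μ := by
    refine (integrable_const (1 : ℝ)).mono' hf.aestronglyMeasurable (ae_of_all _ fun v => ?_)
    simpa using hf1 v
  have hexp : Integrable (fun v => Real.exp (l * f v)) μ := by
    refine (integrable_const (Real.exp 1)).mono' (by fun_prop) (ae_of_all _ fun v => ?_)
    rw [Real.norm_of_nonneg (Real.exp_pos _).le]
    refine Real.exp_le_exp.2 ?_
    have := (abs_le.1 (hf1 v)).2
    nlinarith
  set I : 𝒳 → ℝ := {v | f v ≠ 0}.indicator fun _ => 1 with hI
  have hIint : Integrable I μ := (integrable_const (1 : ℝ)).indicator hset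
  have hpt : ∀ v, Real.exp (l * f v) ≤ 1 + l * f v + l ^ 2 * I v := by
    intro v
    by_cases hv : f v = 0
    · have : 0 ≤ I v := indicator_nonneg (fun _ _ => zero_le_one) v
      rw [hv]
      simp only [mul_zero, Real.exp_zero, add_zero]
      nlinarith [sq_nonneg l]
    · have hIv : I v = 1 := indicator_of_mem (s := {v | f v ≠ 0}) hv _
      have hle : |l * f v| ≤ l := by
        rw [abs_mul, abs_of_pos hl0]
        exact mul_le_of_le_one_right hl0.le (hf1 v)
      have h2 := (abs_le.1 (Real.abs_exp_sub_one_sub_id_le (hle.trans hl1))).2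
      have h3 : (l * f v) ^ 2 ≤ l ^ 2 := by
        rw [← sq_abs]
        exact pow_le_pow_left₀ (abs_nonneg _) hle 2
      rw [hIv]
      linarith
  have i1 : Integrable (fun v => 1 + l * f v) μ := (integrable_const _).add (hfint.const_mul _)
  have i2 : Integrable (fun v => l ^ 2 * I v) μ := hIint.const_mul _
  have hIval : ∫ v, I v ∂μ = μ.real {v | f v ≠ 0} := by
    rw [hI, integral_indicator_const _ hset]
    simp
  have hle : ∫ v, Real.exp (l * f v) ∂μ ≤ Real.exp (l * ∫ v, f v ∂μ + l ^ 2 * σ) := by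
    have h1 : ∫ v, Real.exp (l * f v) ∂μ ≤ ∫ v, (1 + l * f v + l ^ 2 * I v) ∂μ :=
      integral_mono hexp (i1.add i2) hpt
    rw [integral_add i1 i2, integral_add (integrable_const _) (hfint.const_mul _),
      integral_const_mul, integral_const_mul, hIval] at h1
    simp only [integral_const, probReal_univ, smul_eq_mul, mul_one] at h1
    have h2 := Real.add_one_le_exp (l * ∫ v, f v ∂μ + l ^ 2 * σ)
    have h3 := mul_le_mul_of_nonneg_left hσ (sq_nonneg l)
    linarith
  have key := pi_real_le_sum_le (m := m) hexp hle (l * (m * ∫ v, f v ∂μ + τ))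
  refine (measureReal_mono fun ω hω => ?_).trans (key.trans (le_of_eq ?_))
  · have hω' : τ ≤ ∑ i, f (ω i) - m * ∫ v, f v ∂μ := hω
    show l * (m * ∫ v, f v ∂μ + τ) ≤ ∑ i, l * f (ω i)
    rw [← Finset.mul_sum]
    exact mul_le_mul_of_nonneg_left (by linarith) hl0.le
  · congr 1
    ring

theorem pi_real_bernstein {m : ℕ} {f : 𝒳 → ℝ} (hf : Measurable f) (hf1 : ∀ v, |f v| ≤ 1)
    {σ : ℝ} (hσ : μ.real {v | f v ≠ 0} ≤ σ) {l : ℝ} (hl0 : 0 < l) (hl1 : l ≤ 1) (τ : ℝ) :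
    (Measure.pi fun _ : Fin m => μ).real {ω | τ < |∑ i, f (ω i) - m * ∫ v, f v ∂μ|} ≤
      2 * Real.exp (l ^ 2 * σ * m - l * τ) := by
  have h1 := pi_real_bernstein_upper (m := m) hf hf1 hσ hl0 hl1 τ
  have h2 := pi_real_bernstein_upper (m := m) (f := fun v => -f v) hf.neg (by simpa using hf1)
    (by simpa using hσ) hl0 hl1 τ
  refine (measureReal_mono (fun ω hω => ?_) (by finiteness)).trans
    ((measureReal_union_le _ _).trans ((add_le_add h1 h2).trans (by linarith)))
  have hω' : τ < |∑ i, f (ω i) - m * ∫ v, f v ∂μ| := hω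
  rcases lt_abs.1 hω' with h | h
  · exact Or.inl h.le
  · refine Or.inr ?_
    show τ ≤ ∑ i, -f (ω i) - m * ∫ v, -f v ∂μ
    rw [Finset.sum_neg_distrib, integral_neg]
    linarith

end Chernoff

/-- A class of random variables indexed by `A` with subexponential increments with respect to
`ρ` and marginals with density bounded by `D`. -/
structure SubexpFamily {𝒳 E : Type*} [MeasurableSpace 𝒳] (μ : Measure 𝒳) (A : Set E)
    (φ : E → 𝒳 → ℝ) (ρ : E → E → ℝ) (D : ℝ) : Prop where
  measurable : ∀ x, Measurable (φ x)
  integrable_exp : ∀ x y, 0 < ρ x y →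
    Integrable (fun v => Real.exp (|φ x v - φ y v| / (8 * ρ x y))) μ
  integral_exp_le : ∀ x y, 0 < ρ x y → ∫ v, Real.exp (|φ x v - φ y v| / (8 * ρ x y)) ∂μ ≤ 12
  integrable_exp_self : ∀ x ∈ A, Integrable (fun v => Real.exp (|φ x v| / 8)) μ
  integral_exp_self_le : ∀ x ∈ A, ∫ v, Real.exp (|φ x v| / 8) ∂μ ≤ 12
  small_ball : ∀ x ∈ A, ∀ t h, 0 < h → μ.real {v | t ≤ φ x v ∧ φ x v ≤ t + h} ≤ D * h
  lipschitz : ∀ v, ∃ C, 0 ≤ C ∧ ∀ x y, |φ x v - φ y v| ≤ C * ρ x y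
  nonneg : ∀ x y, 0 ≤ ρ x y
  symm : ∀ x y, ρ x y = ρ y x
  triangle : ∀ x y z, ρ x z ≤ ρ x y + ρ y z

theorem measureReal_lt_le_of_integral_exp_le {𝒳 : Type*} [MeasurableSpace 𝒳] {μ : Measure 𝒳}
    [IsProbabilityMeasure μ] {g : 𝒳 → ℝ} {C : ℝ} (hint : Integrable (fun v => Real.exp (g v)) μ)
    (hC : ∫ v, Real.exp (g v) ∂μ ≤ C) (r : ℝ) : μ.real {v | r < g v} ≤ C * Real.exp (-r) := by
  have hmk := mul_meas_ge_le_integral_of_nonneg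
    (ae_of_all _ fun v => (Real.exp_pos (g v)).le) hint (Real.exp r)
  have hsub : μ.real {v | r < g v} ≤ μ.real {v | Real.exp r ≤ Real.exp (g v)} :=
    measureReal_mono fun v hv => Real.exp_le_exp.2 (le_of_lt hv)
  rw [Real.exp_neg, ← div_eq_mul_inv, le_div_iff₀ (Real.exp_pos _), mul_comm]
  exact ((mul_le_mul_of_nonneg_left hsub (Real.exp_pos r).le).trans hmk).trans hC

/-- The indicator of the half-line `(-∞, t]`. -/
def stepFn (t y : ℝ) : ℝ := if y ≤ t then 1 else 0

theorem measurable_stepFn (t : ℝ) : Measurable (stepFn t) :=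
  Measurable.ite measurableSet_Iic measurable_const measurable_const

theorem abs_stepFn_le (t y : ℝ) : |stepFn t y| ≤ 1 := by
  unfold stepFn
  split <;> simp

theorem abs_stepFn_sub_le (t y z : ℝ) : |stepFn t y - stepFn t z| ≤ 1 := by
  unfold stepFn
  split <;> split <;> simp

theorem abs_sub_le_of_stepFn_ne {t y z : ℝ} (h : stepFn t y - stepFn t z ≠ 0) :
    |z - t| ≤ |y - z| := by
  unfold stepFn at h
  split at h <;> split at h
  · simp at h
  · rw [abs_of_pos (by linarith), abs_of_neg (by linarith)]
    linarith
  · rw [abs_of_nonpos (by linarith), abs_of_pos (by linarith)]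
    linarith
  · simp at h

theorem integral_stepFn {𝒳 : Type*} [MeasurableSpace 𝒳] {μ : Measure 𝒳} {h : 𝒳 → ℝ}
    (hh : Measurable h) (t : ℝ) : ∫ v, stepFn t (h v) ∂μ = cdfOf μ h t := by
  have hset : MeasurableSet {v | h v ≤ t} := hh measurableSet_Iic
  have e : (fun v => stepFn t (h v)) = {v | h v ≤ t}.indicator fun _ => (1 : ℝ) := by
    ext v
    simp [stepFn, indicator]
  rw [e, integral_indicator_const _ hset]
  simp [cdfOf, Measure.real]

theorem integrable_stepFn {𝒳 : Type*} [MeasurableSpace 𝒳] {μ : Measure 𝒳}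
    [IsFiniteMeasure μ] {h : 𝒳 → ℝ} (hh : Measurable h) (t : ℝ) :
    Integrable (fun v => stepFn t (h v)) μ :=
  (integrable_const (1 : ℝ)).mono' ((measurable_stepFn t).comp hh).aestronglyMeasurable
    (ae_of_all _ fun v => by simpa using abs_stepFn_le t (h v))

theorem sum_stepFn {m : ℕ} (hm : 0 < m) (xs : Fin m → ℝ) (t : ℝ) :
    ∑ i, stepFn t (xs i) = m * empCDF xs t := by
  have hm' : (m : ℝ) ≠ 0 := by positivity
  rw [empCDF, mul_div_cancel₀ _ hm']
  simp [stepFn, Finset.sum_boole]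

namespace SubexpFamily

variable {𝒳 E : Type*} [MeasurableSpace 𝒳] {μ : Measure 𝒳} {A : Set E}
  {φ : E → 𝒳 → ℝ} {ρ : E → E → ℝ} {D : ℝ}

theorem eq_of_dist_eq_zero (H : SubexpFamily μ A φ ρ D) {x y : E} (h : ρ x y = 0) (v : 𝒳) :
    φ x v = φ y v := by
  obtain ⟨C, hC, hv⟩ := H.lipschitz v
  have := hv x y
  rw [h, mul_zero] at this
  exact sub_eq_zero.1 (abs_nonpos_iff.1 this)

variable [IsProbabilityMeasure μ]

theorem tail (H : SubexpFamily μ A φ ρ D) (x y : E) {r : ℝ} :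
    μ.real {v | 8 * r * ρ x y < |φ x v - φ y v|} ≤ 12 * Real.exp (-r) := by
  rcases (H.nonneg x y).eq_or_lt with h | h
  · have : {v | 8 * r * ρ x y < |φ x v - φ y v|} = ∅ := by
      ext v
      simp [← h, H.eq_of_dist_eq_zero h.symm v]
    rw [this]
    simp only [measureReal_empty]
    positivity
  · refine le_trans (measureReal_mono fun v hv => ?_) (measureReal_lt_le_of_integral_exp_le
      (H.integrable_exp x y h) (H.integral_exp_le x y h) r)
    have hv' : 8 * r * ρ x y < |φ x v - φ y v| := hv
    show r < _
    rw [lt_div_iff₀ (by positivity)]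
    linarith

theorem tail_self (H : SubexpFamily μ A φ ρ D) {x : E} (hx : x ∈ A) (r : ℝ) :
    μ.real {v | 8 * r < |φ x v|} ≤ 12 * Real.exp (-r) := by
  refine le_trans (measureReal_mono fun v hv => ?_) (measureReal_lt_le_of_integral_exp_le
    (H.integrable_exp_self x hx) (H.integral_exp_self_le x hx) r)
  have hv' : 8 * r < |φ x v| := hv
  show r < _
  rw [lt_div_iff₀ (by positivity)]
  linarith

theorem measureReal_stepFn_ne_le (H : SubexpFamily μ A φ ρ D) (hD : 0 ≤ D) (x : E) {y : E}
    (hy : y ∈ A) (t : ℝ) {l : ℝ} (hl : 0 < l) :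
    μ.real {v | stepFn t (φ x v) - stepFn t (φ y v) ≠ 0} ≤
      16 * D * l * ρ x y + 12 * Real.exp (-l) := by
  rcases (H.nonneg x y).eq_or_lt with h | h
  · have : {v | stepFn t (φ x v) - stepFn t (φ y v) ≠ 0} = ∅ := by
      ext v
      simp [H.eq_of_dist_eq_zero h.symm v]
    rw [this, ← h]
    simp only [measureReal_empty]
    positivity
  · have h1 := H.tail x y (r := l)
    have h2 := H.small_ball y hy (t - 8 * l * ρ x y) (2 * (8 * l * ρ x y)) (by positivity)
    refine (measureReal_mono fun v hv => ?_).trans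
      ((measureReal_union_le _ _).trans ((add_le_add h2 h1).trans (by linarith)))
    by_cases hc : 8 * l * ρ x y < |φ x v - φ y v|
    · exact Or.inr hc
    · refine Or.inl ?_
      have := abs_le.1 ((abs_sub_le_of_stepFn_ne hv).trans (not_lt.1 hc))
      constructor <;> linarith [this.1, this.2]

/-- Deviation of the empirical distribution function at a single point. -/
theorem pi_real_single (H : SubexpFamily μ A φ ρ D) {m : ℕ} (x : E) (t : ℝ) {l : ℝ}
    (hl0 : 0 < l) (hl1 : l ≤ 1) (τ : ℝ) :
    (Measure.pi fun _ : Fin m => μ).real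
      {ω | τ < |∑ i, stepFn t (φ x (ω i)) - m * cdfOf μ (φ x) t|} ≤
      2 * Real.exp (l ^ 2 * m - l * τ) := by
  have := pi_real_bernstein (μ := μ) (m := m) (f := fun v => stepFn t (φ x v))
    ((measurable_stepFn t).comp (H.measurable x)) (fun v => abs_stepFn_le _ _)
    (σ := 1) measureReal_le_one hl0 hl1 τ
  rwa [integral_stepFn (H.measurable x), mul_one] at this

/-- Deviation of an increment of the empirical distribution functions at a single point. -/
theorem pi_real_increment (H : SubexpFamily μ A φ ρ D) (hD : 0 ≤ D) {m : ℕ} (x : E) {y : E}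
    (hy : y ∈ A) (t : ℝ) {L : ℝ} (hL : 0 < L) {l : ℝ} (hl0 : 0 < l) (hl1 : l ≤ 1) (K : ℝ) :
    (Measure.pi fun _ : Fin m => μ).real
      {ω | l * (16 * D * L * ρ x y + 12 * Real.exp (-L)) * m + K / l <
        |∑ i, (stepFn t (φ x (ω i)) - stepFn t (φ y (ω i))) -
          m * (cdfOf μ (φ x) t - cdfOf μ (φ y) t)|} ≤ 2 * Real.exp (-K) := by
  have := pi_real_bernstein (μ := μ) (m := m)
    (f := fun v => stepFn t (φ x v) - stepFn t (φ y v))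
    (((measurable_stepFn t).comp (H.measurable x)).sub
      ((measurable_stepFn t).comp (H.measurable y))) (fun v => abs_stepFn_sub_le _ _ _)
    (H.measureReal_stepFn_ne_le hD x hy t hL) hl0 hl1
    (l * (16 * D * L * ρ x y + 12 * Real.exp (-L)) * m + K / l)
  rw [integral_sub (integrable_stepFn (H.measurable x) t)
    (integrable_stepFn (H.measurable y) t), integral_stepFn (H.measurable x),
    integral_stepFn (H.measurable y)] at this
  refine this.trans (le_of_eq ?_)
  congr 2
  field_simp
  ring

/-- Deviation of the truncated empirical `ℓ¹` norm of an increment. -/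
theorem pi_real_excess (H : SubexpFamily μ A φ ρ D) {m : ℕ} (x y : E) {L K : ℝ}
    (hmL : m * (12 * Real.exp (-L)) ≤ K) :
    (Measure.pi fun _ : Fin m => μ).real
      {ω | 2 * K * (8 * ρ x y) < ∑ i, max (|φ x (ω i) - φ y (ω i)| - 8 * L * ρ x y) 0} ≤
      Real.exp (-K) := by
  rcases (H.nonneg x y).eq_or_lt with h | h
  · have : {ω : Fin m → 𝒳 | 2 * K * (8 * ρ x y) <
        ∑ i, max (|φ x (ω i) - φ y (ω i)| - 8 * L * ρ x y) 0} = ∅ := by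
      ext ω
      simp [← h, fun v => H.eq_of_dist_eq_zero h.symm v]
    rw [this]
    simp only [measureReal_empty]
    positivity
  · have hmx := H.measurable x
    have hmy := H.measurable y
    set g : 𝒳 → ℝ := fun v => max (|φ x v - φ y v| - 8 * L * ρ x y) 0 / (8 * ρ x y) with hg
    have hpt : ∀ v, Real.exp (g v) ≤
        1 + Real.exp (|φ x v - φ y v| / (8 * ρ x y)) * Real.exp (-L) := by
      intro v
      have e : Real.exp (|φ x v - φ y v| / (8 * ρ x y)) * Real.exp (-L) =
          Real.exp ((|φ x v - φ y v| - 8 * L * ρ x y) / (8 * ρ x y)) := by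
        rw [← Real.exp_add]
        congr 1
        field_simp
        ring
      rw [e]
      rcases le_total (|φ x v - φ y v| - 8 * L * ρ x y) 0 with hc | hc
      · simp only [hg, max_eq_right hc, zero_div, Real.exp_zero]
        linarith [Real.exp_pos ((|φ x v - φ y v| - 8 * L * ρ x y) / (8 * ρ x y))]
      · simp only [hg, max_eq_left hc]
        linarith
    have hdom : Integrable (fun v => 1 + Real.exp (|φ x v - φ y v| / (8 * ρ x y)) *
        Real.exp (-L)) μ := (integrable_const _).add ((H.integrable_exp x y h).mul_const _)
    have hint : Integrable (fun v => Real.exp (g v)) μ := by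
      refine hdom.mono' (by fun_prop) (ae_of_all _ fun v => ?_)
      rw [Real.norm_of_nonneg (Real.exp_pos _).le]
      exact hpt v
    have hle : ∫ v, Real.exp (g v) ∂μ ≤ Real.exp (12 * Real.exp (-L)) := by
      have h1 : ∫ v, Real.exp (g v) ∂μ ≤ _ := integral_mono hint hdom hpt
      rw [integral_add (integrable_const _) ((H.integrable_exp x y h).mul_const _),
        integral_mul_const] at h1
      simp only [integral_const, probReal_univ, smul_eq_mul, mul_one] at h1
      have h2 := Real.add_one_le_exp (12 * Real.exp (-L))
      have h3 := mul_le_mul_of_nonneg_right (H.integral_exp_le x y h) (Real.exp_pos (-L)).le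
      linarith
    refine (measureReal_mono fun ω hω => ?_).trans
      ((pi_real_le_sum_le (m := m) hint hle (2 * K)).trans (Real.exp_le_exp.2 (by linarith)))
    have hω' : 2 * K * (8 * ρ x y) <
      ∑ i, max (|φ x (ω i) - φ y (ω i)| - 8 * L * ρ x y) 0 := hω
    show 2 * K ≤ ∑ i, g (ω i)
    simp only [hg]
    rw [← Finset.sum_div, le_div_iff₀ (by positivity)]
    exact hω'.le

end SubexpFamily

/-- Two monotone functions which are close on a grid, up to tails, are close up to a shift by the
mesh of the grid. -/
theorem le_shift_of_grid {G F : ℝ → ℝ} (hG : Monotone G) (hF : Monotone F)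
    (hG0 : ∀ t, 0 ≤ G t) (hG1 : ∀ t, G t ≤ 1) (hF0 : ∀ t, 0 ≤ F t) (hF1 : ∀ t, F t ≤ 1)
    {δ η κ : ℝ} (hδ : 0 < δ) {J : ℕ} (hlow : F (-(J * δ)) ≤ κ)
    (hhigh : 1 - κ ≤ F (J * δ)) (h : ∀ j : ℤ, |j| ≤ J → |G (j * δ) - F (j * δ)| ≤ η) (t : ℝ) :
    G t ≤ F (t + δ) + η + κ ∧ F (t - δ) - η - κ ≤ G t := by
  have hη : 0 ≤ η := (abs_nonneg _).trans (h 0 (by simp))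
  have hκ : 0 ≤ κ := (hF0 _).trans hlow
  have hJp := abs_le.1 (h J (by simp))
  have hJm := abs_le.1 (h (-J) (by simp))
  push_cast at hJp hJm
  rw [neg_mul] at hJm
  constructor
  · have c1 : t ≤ ⌈t / δ⌉ * δ := (div_le_iff₀ hδ).1 (Int.le_ceil _)
    have c2 : ⌈t / δ⌉ * δ ≤ t + δ := by
      have := (Int.ceil_lt_add_one (t / δ)).le
      calc _ ≤ (t / δ + 1) * δ := mul_le_mul_of_nonneg_right this hδ.le
        _ = t + δ := by field_simp
    rcases le_or_gt |⌈t / δ⌉| (J : ℤ) with hj | hj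
    · have := (abs_le.1 (h _ hj)).2
      linarith [hG c1, hF c2]
    · rcases lt_abs.1 hj with hj | hj
      · have h1 : (J : ℝ) < t / δ := by simpa using Int.lt_ceil.1 hj
        have h2 : J * δ ≤ t + δ := by
          have := (lt_div_iff₀ hδ).1 h1
          linarith
        linarith [hF h2, hG1 t]
      · have h1 : t / δ ≤ -(J : ℝ) := by
          have : ⌈t / δ⌉ ≤ -(J : ℤ) := by linarith
          simpa using Int.ceil_le.1 this
        have h2 : t ≤ -(J * δ) := by
          have := (div_le_iff₀ hδ).1 h1
          linarith
        linarith [hG h2, hF0 (t + δ)]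
  · have c1 : ⌊t / δ⌋ * δ ≤ t := (le_div_iff₀ hδ).1 (Int.floor_le _)
    have c2 : t - δ ≤ ⌊t / δ⌋ * δ := by
      have := (Int.sub_one_lt_floor (t / δ)).le
      calc _ = (t / δ - 1) * δ := by field_simp
        _ ≤ _ := mul_le_mul_of_nonneg_right this hδ.le
    rcases le_or_gt |⌊t / δ⌋| (J : ℤ) with hj | hj
    · have := (abs_le.1 (h _ hj)).1
      linarith [hG c1, hF c2]
    · rcases lt_abs.1 hj with hj | hj
      · have h1 : (J : ℝ) ≤ t / δ := by simpa using Int.le_floor.1 hj.le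
        have h2 : J * δ ≤ t := (le_div_iff₀ hδ).1 h1
        linarith [hG h2, hF1 (t - δ)]
      · have h1 : t / δ < -(J : ℝ) := by
          have : ⌊t / δ⌋ < -(J : ℤ) := by linarith
          simpa using Int.floor_lt.1 this
        have h2 : t - δ ≤ -(J * δ) := by
          have := (div_lt_iff₀ hδ).1 h1
          linarith
        linarith [hF h2, hG0 t]

theorem empCDF_mono {m : ℕ} (xs : Fin m → ℝ) : Monotone (empCDF xs) := by
  intro s t hst
  refine div_le_div_of_nonneg_right (Nat.cast_le.2 (Finset.card_le_card ?_)) (Nat.cast_nonneg m)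
  exact Finset.monotone_filter_right _ fun i _ hi => le_trans hi hst

theorem empCDF_nonneg {m : ℕ} (xs : Fin m → ℝ) (t : ℝ) : 0 ≤ empCDF xs t := by
  unfold empCDF
  positivity

theorem empCDF_le_one {m : ℕ} (xs : Fin m → ℝ) (t : ℝ) : empCDF xs t ≤ 1 := by
  refine div_le_one_of_le₀ (Nat.cast_le.2 ?_) (Nat.cast_nonneg m)
  exact (Finset.card_filter_le _ _).trans (by simp)

theorem empCDF_le_shift {m : ℕ} (xs ys : Fin m → ℝ) (t δ : ℝ) :
    empCDF xs t ≤ empCDF ys (t + δ) +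
      ((Finset.univ.filter fun i => δ < |xs i - ys i|).card : ℝ) / m := by
  unfold empCDF
  rw [← add_div]
  refine div_le_div_of_nonneg_right ?_ (Nat.cast_nonneg m)
  rw [← Nat.cast_add]
  refine Nat.cast_le.2 ((Finset.card_le_card fun i hi => ?_).trans (Finset.card_union_le _ _))
  simp only [Finset.mem_filter, Finset.mem_univ, true_and, Finset.mem_union] at *
  by_contra! hc
  linarith [(abs_le.1 hc.2).1]

section CDF

variable {𝒳 : Type*} [MeasurableSpace 𝒳] {μ : Measure 𝒳}

theorem cdfOf_nonneg (h : 𝒳 → ℝ) (t : ℝ) : 0 ≤ cdfOf μ h t := ENNReal.toReal_nonneg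

variable [IsProbabilityMeasure μ]

theorem cdfOf_mono (h : 𝒳 → ℝ) : Monotone (cdfOf μ h) := fun _ _ hst =>
  measureReal_mono (μ := μ) fun _ hv => le_trans hv hst

theorem cdfOf_le_one (h : 𝒳 → ℝ) (t : ℝ) : cdfOf μ h t ≤ 1 := measureReal_le_one (μ := μ)

theorem cdfOf_le_shift (h g : 𝒳 → ℝ) (t δ : ℝ) :
    cdfOf μ h t ≤ cdfOf μ g (t + δ) + μ.real {v | δ < |h v - g v|} := by
  refine (measureReal_mono (μ := μ) fun v hv => ?_).trans (measureReal_union_le _ _)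
  by_contra! hc
  have hv' : h v ≤ t := hv
  simp only [mem_union, mem_ofPred_eq, not_or, not_le, not_lt] at hc
  linarith [(abs_le.1 hc.2).1]

theorem SubexpFamily.cdfOf_add_le {E : Type*} {A : Set E} {φ : E → 𝒳 → ℝ} {ρ : E → E → ℝ}
    {D : ℝ} (H : SubexpFamily μ A φ ρ D) {x : E} (hx : x ∈ A) (t h : ℝ) (hh : 0 < h) :
    cdfOf μ (φ x) (t + h) ≤ cdfOf μ (φ x) t + D * h := by
  refine (measureReal_mono (μ := μ) fun v hv => ?_).trans
    ((measureReal_union_le _ _).trans (add_le_add_right (H.small_ball x hx t h hh) _))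
  by_contra! hc
  have hv' : φ x v ≤ t + h := hv
  simp only [mem_union, mem_ofPred_eq, not_or, not_le] at hc
  exact hc.2 ⟨hc.1.le, hv'⟩

theorem SubexpFamily.cdfOf_neg_le {E : Type*} {A : Set E} {φ : E → 𝒳 → ℝ} {ρ : E → E → ℝ}
    {D : ℝ} (H : SubexpFamily μ A φ ρ D) {x : E} (hx : x ∈ A) {ε t : ℝ} (hε : 0 < ε)
    (ht : 1536 / ε < t) : cdfOf μ (φ x) (-t) ≤ ε / 16 ∧ 1 - ε / 16 ≤ cdfOf μ (φ x) t := by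
  have ht0 : 0 < 1536 / ε := by positivity
  have key : μ.real {v | 1536 / ε < |φ x v|} ≤ ε / 16 := by
    have h1 := H.tail_self hx (192 / ε)
    have h2 : Real.exp (-(192 / ε)) ≤ ε / 192 := by
      rw [Real.exp_neg, inv_le_comm₀ (Real.exp_pos _) (by positivity), inv_div]
      linarith [Real.add_one_le_exp (192 / ε)]
    have e : 8 * (192 / ε) = 1536 / ε := by ring
    rw [e] at h1
    linarith
  constructor
  · refine (measureReal_mono (μ := μ) fun v hv => ?_).trans key
    have hv' : φ x v ≤ -t := hv
    show _ < |φ x v|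
    exact lt_abs.2 (Or.inr (by linarith))
  · have hset : MeasurableSet {v | φ x v ≤ t} := H.measurable x measurableSet_Iic
    have := probReal_compl_eq_one_sub (μ := μ) hset
    have h3 : μ.real {v | φ x v ≤ t}ᶜ ≤ ε / 16 := by
      refine (measureReal_mono (μ := μ) fun v hv => ?_).trans key
      have hv' : t < φ x v := not_le.1 hv
      show _ < |φ x v|
      exact lt_abs.2 (Or.inl (by linarith))
    have h4 : cdfOf μ (φ x) t = μ.real {v | φ x v ≤ t} := rfl
    rw [h4]
    linarith

/-- Transfer of a grid estimate for the distribution functions at `y` to a uniform estimate at a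
nearby point `x`. -/
theorem SubexpFamily.abs_empCDF_sub_le {E : Type*} {A : Set E} {φ : E → 𝒳 → ℝ}
    {ρ : E → E → ℝ} {D : ℝ} (H : SubexpFamily μ A φ ρ D) (hD : 0 < D) {x y : E} (hx : x ∈ A)
    (hy : y ∈ A) {m : ℕ} {ω : Fin m → 𝒳} {ε δ : ℝ} (hε : 0 < ε) (hδ : δ = ε / (16 * D)) {J : ℕ}
    (hJ : 1536 / ε < J * δ)
    (hcount : ((Finset.univ.filter fun i => δ < |φ x (ω i) - φ y (ω i)|).card : ℝ) / m ≤ ε / 8)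
    (hmeas : μ.real {v | δ < |φ x v - φ y v|} ≤ ε / 8)
    (hgrid : ∀ j : ℤ, |j| ≤ J →
      |empCDF (fun i => φ y (ω i)) (j * δ) - cdfOf μ (φ y) (j * δ)| ≤ ε / 4) (t : ℝ) :
    |empCDF (fun i => φ x (ω i)) t - cdfOf μ (φ x) t| ≤ ε := by
  have hδ0 : 0 < δ := by rw [hδ]; positivity
  have htail := H.cdfOf_neg_le hy hε hJ
  have hsh := le_shift_of_grid (empCDF_mono fun i => φ y (ω i)) (cdfOf_mono (μ := μ) (φ y))
    (empCDF_nonneg _) (empCDF_le_one _) (cdfOf_nonneg _) (cdfOf_le_one _) hδ0 htail.1 htail.2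
    hgrid
  have hcount' : ((Finset.univ.filter fun i => δ < |φ y (ω i) - φ x (ω i)|).card : ℝ) / m ≤
      ε / 8 := by
    simpa only [abs_sub_comm] using hcount
  have hmeas' : μ.real {v | δ < |φ y v - φ x v|} ≤ ε / 8 := by
    simpa only [abs_sub_comm] using hmeas
  have hDδ : D * (3 * δ) = 3 * ε / 16 := by
    rw [hδ]
    field_simp
  rw [abs_le]
  constructor
  · have h1 := empCDF_le_shift (fun i => φ y (ω i)) (fun i => φ x (ω i)) (t - δ) δ
    have h2 := (hsh (t - δ)).2
    have h3 := cdfOf_le_shift (μ := μ) (φ x) (φ y) (t - 3 * δ) δ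
    have h4 := H.cdfOf_add_le hx (t - 3 * δ) (3 * δ) (by positivity)
    have e1 : t - δ - δ = t - 3 * δ + δ := by ring
    rw [e1] at h2
    rw [sub_add_cancel] at h1 h4
    linarith
  · have h1 := empCDF_le_shift (fun i => φ x (ω i)) (fun i => φ y (ω i)) t δ
    have h2 := (hsh (t + δ)).1
    have h3 := cdfOf_le_shift (μ := μ) (φ y) (φ x) (t + δ + δ) δ
    have h4 := H.cdfOf_add_le hx t (3 * δ) (by positivity)
    have e1 : t + δ + δ + δ = t + 3 * δ := by ring
    rw [e1] at h3
    linarith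

end CDF

namespace SubexpFamily

variable {𝒳 E : Type*} [MeasurableSpace 𝒳] {μ : Measure 𝒳}
  {A : Set E} {φ : E → 𝒳 → ℝ} {ρ : E → E → ℝ} {D : ℝ}

theorem sum_increment_le (H : SubexpFamily μ A φ ρ D) {x : E} {p : ℕ → E} {γ : ℝ}
    (hsum : ∀ n, ∑ s ∈ Finset.range n, (2 : ℝ) ^ s * ρ x (p s) ≤ 2 * γ) {F : Finset ℕ} :
    ∑ s ∈ F, (2 : ℝ) ^ s * ρ (p (s + 1)) (p s) ≤ 3 * γ := by
  obtain ⟨n, hn⟩ := F.exists_nat_subset_range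
  refine (Finset.sum_le_sum_of_subset_of_nonneg hn fun s _ _ =>
    mul_nonneg (by positivity) (H.nonneg _ _)).trans ?_
  have h1 : ∑ s ∈ Finset.range n, (2 : ℝ) ^ s * ρ (p (s + 1)) (p s) ≤
      ∑ s ∈ Finset.range n, ((2 : ℝ) ^ s * ρ x (p s) +
        1 / 2 * ((2 : ℝ) ^ (s + 1) * ρ x (p (s + 1)))) := by
    refine Finset.sum_le_sum fun s _ => ?_
    have := H.triangle (p (s + 1)) x (p s)
    rw [H.symm (p (s + 1)) x] at this
    calc _ ≤ (2 : ℝ) ^ s * (ρ x (p (s + 1)) + ρ x (p s)) :=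
          mul_le_mul_of_nonneg_left this (by positivity)
      _ = _ := by ring
  rw [Finset.sum_add_distrib, ← Finset.mul_sum] at h1
  have h2 := hsum (n + 1)
  rw [Finset.sum_range_succ'] at h2
  have h3 : 0 ≤ (2 : ℝ) ^ 0 * ρ x (p 0) := mul_nonneg (by positivity) (H.nonneg _ _)
  linarith [hsum n]

theorem pow_mul_dist_le (H : SubexpFamily μ A φ ρ D) {x : E} {p : ℕ → E} {γ : ℝ}
    (hsum : ∀ n, ∑ s ∈ Finset.range n, (2 : ℝ) ^ s * ρ x (p s) ≤ 2 * γ) (s : ℕ) :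
    (2 : ℝ) ^ s * ρ x (p s) ≤ 2 * γ :=
  (Finset.single_le_sum (f := fun s => (2 : ℝ) ^ s * ρ x (p s))
    (fun s _ => mul_nonneg (by positivity) (H.nonneg _ _))
    (Finset.self_mem_range_succ s)).trans (hsum (s + 1))

/-- Telescoping along the chain up to level `s₁` at a grid point. -/
theorem chain_deviation_le (H : SubexpFamily μ A φ ρ D) (hD : 1 ≤ D) {m : ℕ}
    {γ ε L q : ℝ} (hγ : 1 ≤ γ) (hε0 : 0 < ε) (hε1 : ε < 1) (hL : 1 ≤ L)
    (hexp : m * Real.exp (-L) ≤ γ) (hS : 10 ^ 7 * D * γ * L ^ 2 ≤ ε ^ 2 * m)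
    (hq : q = 4096 * D * L * γ / ε) {x : E} {p : ℕ → E}
    (hsum : ∀ n, ∑ s ∈ Finset.range n, (2 : ℝ) ^ s * ρ x (p s) ≤ 2 * γ)
    {s₀ s₁ : ℕ} (h01 : s₀ ≤ s₁) (hlam : ∑ s ∈ Finset.Ico s₀ s₁, (2 : ℝ) ^ s / q ≤ 2)
    (hlev : (s₁ : ℝ) - s₀ ≤ 2 * L) {ω : Fin m → 𝒳} {t : ℝ}
    (hstart : |∑ i, stepFn t (φ (p s₀) (ω i)) - m * cdfOf μ (φ (p s₀)) t| ≤ ε * m / 8)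
    (hinc : ∀ s, s₀ ≤ s → s < s₁ →
      |∑ i, (stepFn t (φ (p (s + 1)) (ω i)) - stepFn t (φ (p s) (ω i))) -
        m * (cdfOf μ (φ (p (s + 1))) t - cdfOf μ (φ (p s)) t)| ≤
      2 ^ s / q * (16 * D * L * ρ (p (s + 1)) (p s) + 12 * Real.exp (-L)) * m +
        8 * 2 ^ s / (2 ^ s / q)) :
    |∑ i, stepFn t (φ (p s₁) (ω i)) - m * cdfOf μ (φ (p s₁)) t| ≤ ε * m / 4 := by
  have hq0 : 0 < q := by rw [hq]; positivity
  set W : ℕ → ℝ := fun s => ∑ i, stepFn t (φ (p s) (ω i)) - m * cdfOf μ (φ (p s)) t with hW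
  have htel : W s₁ = W s₀ + ∑ s ∈ Finset.Ico s₀ s₁, (W (s + 1) - W s) := by
    rw [Finset.sum_Ico_sub _ h01]
    ring
  have hstep : ∀ s ∈ Finset.Ico s₀ s₁, |W (s + 1) - W s| ≤
      16 * D * L * m / q * (2 ^ s * ρ (p (s + 1)) (p s)) +
        12 * (m * Real.exp (-L)) * (2 ^ s / q) + 8 * q := by
    intro s hs
    rw [Finset.mem_Ico] at hs
    refine le_trans (le_of_eq ?_) ((hinc s hs.1 hs.2).trans (le_of_eq ?_))
    · rw [Finset.sum_sub_distrib]
      congr 1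
      simp only [hW]
      ring
    · field_simp
  have hcard : ((Finset.Ico s₀ s₁).card : ℝ) = (s₁ : ℝ) - s₀ := by
    rw [Nat.card_Ico, Nat.cast_sub h01]
  have hbound := (Finset.abs_sum_le_sum_abs _ _).trans (Finset.sum_le_sum hstep)
  rw [Finset.sum_add_distrib, Finset.sum_add_distrib, ← Finset.mul_sum, ← Finset.mul_sum,
    Finset.sum_const, nsmul_eq_mul, hcard] at hbound
  have hm0 : (0 : ℝ) ≤ m := Nat.cast_nonneg m
  have hbase : 10 ^ 7 * (D * γ * L ^ 2) ≤ ε ^ 2 * m := by linarith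
  have hγDL : γ ≤ D * γ * L ^ 2 := by
    have h1 : (1 : ℝ) ≤ D * L ^ 2 := one_le_mul_of_one_le_of_one_le hD (one_le_pow₀ hL)
    nlinarith
  have t1 : 16 * D * L * m / q *
      ∑ s ∈ Finset.Ico s₀ s₁, (2 : ℝ) ^ s * ρ (p (s + 1)) (p s) ≤ ε * m / 32 := by
    calc _ ≤ 16 * D * L * m / q * (3 * γ) :=
          mul_le_mul_of_nonneg_left (H.sum_increment_le hsum) (by positivity)
      _ = 48 / 4096 * (ε * m) := by
        rw [hq]
        field_simp
        ring
      _ ≤ ε * m / 32 := by nlinarith [mul_nonneg hε0.le hm0]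
  have hγm : 10 ^ 7 * γ ≤ ε * m := by
    have h1 : ε ^ 2 * m ≤ ε * m := by
      refine mul_le_mul_of_nonneg_right ?_ hm0
      nlinarith
    linarith
  have t2 : 12 * (m * Real.exp (-L)) * ∑ s ∈ Finset.Ico s₀ s₁, (2 : ℝ) ^ s / q ≤
      ε * m / 32 := by
    calc _ ≤ 12 * γ * 2 := by
          refine mul_le_mul (by linarith) hlam (Finset.sum_nonneg fun s _ => by positivity)
            (by positivity)
      _ ≤ _ := by linarith
  have t3 : ((s₁ : ℝ) - s₀) * (8 * q) ≤ ε * m / 32 := by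
    calc _ ≤ 2 * L * (8 * q) := mul_le_mul_of_nonneg_right hlev (by positivity)
      _ = 65536 * (D * γ * L ^ 2) / ε := by
        rw [hq]
        ring
      _ ≤ _ := by
        rw [div_le_iff₀ hε0]
        nlinarith
  show |W s₁| ≤ _
  rw [htel]
  refine (abs_add_le _ _).trans ?_
  have : |W s₀| ≤ ε * m / 8 := hstart
  linarith [mul_nonneg hε0.le hm0]

/-- Few sample points see a large gap between `x` and its approximation at level `s₁`. -/
theorem chain_card_le (H : SubexpFamily μ A φ ρ D) (hD : 1 ≤ D) {m : ℕ}
    {γ ε L q δ : ℝ} (hγ : 1 ≤ γ) (hε0 : 0 < ε) (hL : 1 ≤ L)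
    (hS : 10 ^ 7 * D * γ * L ^ 2 ≤ ε ^ 2 * m)
    (hq : q = 4096 * D * L * γ / ε) (hδ : δ = ε / (16 * D)) {x : E} {p : ℕ → E}
    (hsum : ∀ n, ∑ s ∈ Finset.range n, (2 : ℝ) ^ s * ρ x (p s) ≤ 2 * γ)
    {s₁ : ℕ} (h1 : q ≤ 2 ^ s₁) {ω : Fin m → 𝒳}
    (hexc : ∀ s, s₁ ≤ s →
      ∑ i, max (|φ (p (s + 1)) (ω i) - φ (p s) (ω i)| - 8 * L * ρ (p (s + 1)) (p s)) 0 ≤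
        2 * (8 * 2 ^ s) * (8 * ρ (p (s + 1)) (p s))) :
    ((Finset.univ.filter fun i => δ < |φ x (ω i) - φ (p s₁) (ω i)|).card : ℝ) ≤ ε * m / 8 := by
  have hq0 : 0 < q := by rw [hq]; positivity
  have hδ0 : 0 < δ := by rw [hδ]; positivity
  choose C hC0 hC using fun i => H.lipschitz (ω i)
  have hCsum : ∀ i, C i ≤ ∑ i, C i := fun i =>
    Finset.single_le_sum (fun i _ => hC0 i) (Finset.mem_univ i)
  set K := ∑ i, C i with hK
  have hK0 : 0 ≤ K := Finset.sum_nonneg fun i _ => hC0 i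
  obtain ⟨N₀, hN₀⟩ := pow_unbounded_of_one_lt (8 * γ * K / δ) (one_lt_two (α := ℝ))
  set N := max N₀ s₁ with hN
  have hsN : s₁ ≤ N := le_max_right _ _
  have hNK : 8 * γ * K ≤ δ * 2 ^ N := by
    have h2 : (2 : ℝ) ^ N₀ ≤ 2 ^ N := pow_le_pow_right₀ one_le_two (le_max_left _ _)
    have h3 := (div_lt_iff₀ hδ0).1 hN₀
    nlinarith
  have hend : ∀ i, |φ x (ω i) - φ (p N) (ω i)| ≤ δ / 4 := by
    intro i
    have h2 := H.pow_mul_dist_le hsum N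
    have h3 : |φ x (ω i) - φ (p N) (ω i)| ≤ K * ρ x (p N) :=
      (hC i x (p N)).trans (mul_le_mul_of_nonneg_right (hCsum i) (H.nonneg _ _))
    refine h3.trans ?_
    have h4 : (0 : ℝ) < 2 ^ N := by positivity
    have h5 : K * ((2 : ℝ) ^ N * ρ x (p N)) ≤ K * (2 * γ) := mul_le_mul_of_nonneg_left h2 hK0
    refine le_of_mul_le_mul_left ?_ h4
    nlinarith
  set u : ℕ → ℝ := fun s => ρ (p (s + 1)) (p s) with hu
  have hu0 : ∀ s, 0 ≤ u s := fun s => H.nonneg _ _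
  have hinc : ∑ s ∈ Finset.Ico s₁ N, (2 : ℝ) ^ s * u s ≤ 3 * γ := H.sum_increment_le hsum
  have hθ : ∑ s ∈ Finset.Ico s₁ N, 8 * L * u s ≤ δ / 4 := by
    have h2 : q * ∑ s ∈ Finset.Ico s₁ N, u s ≤ 3 * γ := by
      rw [Finset.mul_sum]
      refine (Finset.sum_le_sum fun s hs => ?_).trans hinc
      refine mul_le_mul_of_nonneg_right (h1.trans ?_) (hu0 s)
      exact pow_le_pow_right₀ one_le_two (Finset.mem_Ico.1 hs).1
    rw [← Finset.mul_sum]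
    have h3 : ∑ s ∈ Finset.Ico s₁ N, u s ≤ 3 * γ / q := by
      rw [le_div_iff₀ hq0]
      linarith
    calc _ ≤ 8 * L * (3 * γ / q) := mul_le_mul_of_nonneg_left h3 (by positivity)
      _ = 24 / 4096 * (ε / D) := by
        rw [hq]
        field_simp
        norm_num
      _ ≤ δ / 4 := by
        have : δ / 4 = 1 / 64 * (ε / D) := by
          rw [hδ]
          field_simp
          norm_num
        rw [this]
        exact mul_le_mul_of_nonneg_right (by norm_num) (by positivity)
  set M : ℕ → Fin m → ℝ := fun s i =>
    max (|φ (p (s + 1)) (ω i) - φ (p s) (ω i)| - 8 * L * u s) 0 with hM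
  have hchain : ∀ i, |φ x (ω i) - φ (p s₁) (ω i)| ≤
      δ / 4 + δ / 4 + ∑ s ∈ Finset.Ico s₁ N, M s i := by
    intro i
    have htel : φ x (ω i) - φ (p s₁) (ω i) = (φ x (ω i) - φ (p N) (ω i)) +
        ∑ s ∈ Finset.Ico s₁ N, (φ (p (s + 1)) (ω i) - φ (p s) (ω i)) := by
      rw [Finset.sum_Ico_sub (fun s => φ (p s) (ω i)) hsN]
      ring
    have h2 : ∑ s ∈ Finset.Ico s₁ N, |φ (p (s + 1)) (ω i) - φ (p s) (ω i)| ≤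
        ∑ s ∈ Finset.Ico s₁ N, (8 * L * u s + M s i) := by
      refine Finset.sum_le_sum fun s _ => ?_
      have := le_max_left (|φ (p (s + 1)) (ω i) - φ (p s) (ω i)| - 8 * L * u s) 0
      simp only [hM]
      linarith
    rw [Finset.sum_add_distrib] at h2
    rw [htel]
    have h3 := abs_add_le (φ x (ω i) - φ (p N) (ω i))
      (∑ s ∈ Finset.Ico s₁ N, (φ (p (s + 1)) (ω i) - φ (p s) (ω i)))
    have h4 := Finset.abs_sum_le_sum_abs
      (fun s => φ (p (s + 1)) (ω i) - φ (p s) (ω i)) (Finset.Ico s₁ N)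
    linarith [hend i]
  have hM0 : ∀ s i, 0 ≤ M s i := fun s i => le_max_right _ _
  have hcount : ((Finset.univ.filter fun i => δ < |φ x (ω i) - φ (p s₁) (ω i)|).card : ℝ) *
      (δ / 2) ≤ ∑ i, ∑ s ∈ Finset.Ico s₁ N, M s i := by
    rw [← nsmul_eq_mul]
    refine (Finset.card_nsmul_le_sum _ (fun i => ∑ s ∈ Finset.Ico s₁ N, M s i) _
      fun i hi => ?_).trans (Finset.sum_le_sum_of_subset_of_nonneg (Finset.filter_subset _ _)
        fun i _ _ => Finset.sum_nonneg fun s _ => hM0 s i)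
    have := (Finset.mem_filter.1 hi).2
    linarith [hchain i]
  rw [Finset.sum_comm] at hcount
  have htot : ∑ s ∈ Finset.Ico s₁ N, ∑ i, M s i ≤ 384 * γ := by
    calc _ ≤ ∑ s ∈ Finset.Ico s₁ N, 128 * ((2 : ℝ) ^ s * u s) := by
          refine Finset.sum_le_sum fun s hs => ?_
          refine (hexc s (Finset.mem_Ico.1 hs).1).trans (le_of_eq ?_)
          simp only [hu]
          ring
      _ ≤ _ := by
        rw [← Finset.mul_sum]
        linarith
  have hm0 : (0 : ℝ) ≤ m := Nat.cast_nonneg m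
  have hbase : 10 ^ 7 * (D * γ) ≤ ε ^ 2 * m := by
    have : D * γ * 1 ≤ D * γ * L ^ 2 :=
      mul_le_mul_of_nonneg_left (one_le_pow₀ hL) (by positivity)
    linarith
  have hfin : 384 * γ ≤ ε * m / 8 * (δ / 2) := by
    have : ε * m / 8 * (δ / 2) = ε ^ 2 * m / (256 * D) := by
      rw [hδ]
      field_simp
      ring
    rw [this, le_div_iff₀ (by positivity)]
    linarith [mul_nonneg (show (0 : ℝ) ≤ D by linarith) (show (0 : ℝ) ≤ γ by linarith)]
  exact le_of_mul_le_mul_right ((hcount.trans htot).trans hfin) (by positivity)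

theorem chain_measureReal_le [IsProbabilityMeasure μ] (H : SubexpFamily μ A φ ρ D) (hD : 1 ≤ D)
    {m : ℕ} (hm : 0 < m) {γ ε L q δ : ℝ} (hγ : 1 ≤ γ) (hε0 : 0 < ε) (hε1 : ε < 1) (hL : 1 ≤ L)
    (hexp : m * Real.exp (-L) ≤ γ) (hS : 10 ^ 7 * D * γ * L ^ 2 ≤ ε ^ 2 * m)
    (hq : q = 4096 * D * L * γ / ε) (hδ : δ = ε / (16 * D)) {x : E} {p : ℕ → E}
    (hsum : ∀ n, ∑ s ∈ Finset.range n, (2 : ℝ) ^ s * ρ x (p s) ≤ 2 * γ)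
    {s₁ : ℕ} (h1 : q ≤ 2 ^ s₁) :
    μ.real {v | δ < |φ x v - φ (p s₁) v|} ≤ ε / 8 := by
  have hq0 : 0 < q := by rw [hq]; positivity
  have hm0 : (0 : ℝ) < m := Nat.cast_pos.2 hm
  have hdist : 8 * L * ρ x (p s₁) ≤ δ := by
    have h2 : ρ x (p s₁) ≤ 2 * γ / q := by
      rw [le_div_iff₀ hq0, mul_comm]
      exact (mul_le_mul_of_nonneg_right h1 (H.nonneg _ _)).trans (H.pow_mul_dist_le hsum s₁)
    calc _ ≤ 8 * L * (2 * γ / q) := mul_le_mul_of_nonneg_left h2 (by positivity)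
      _ = 16 / 4096 * (ε / D) := by
        rw [hq]
        field_simp
        norm_num
      _ ≤ δ := by
        have : δ = 1 / 16 * (ε / D) := by
          rw [hδ]
          field_simp
        rw [this]
        exact mul_le_mul_of_nonneg_right (by norm_num) (by positivity)
  refine (measureReal_mono fun v hv => lt_of_le_of_lt hdist hv).trans
    ((H.tail x (p s₁) (r := L)).trans ?_)
  have hγDL : γ ≤ D * γ * L ^ 2 := by
    have h1 : (1 : ℝ) ≤ D * L ^ 2 := one_le_mul_of_one_le_of_one_le hD (one_le_pow₀ hL)
    nlinarith
  have h2 : ε ^ 2 * m ≤ ε * m := by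
    refine mul_le_mul_of_nonneg_right ?_ hm0.le
    nlinarith
  refine le_of_mul_le_mul_left ?_ hm0
  nlinarith

end SubexpFamily

theorem measureReal_exists_mem_le {Ω ι : Type*} [MeasurableSpace Ω] {P : Measure Ω}
    (S : Finset ι) {B : ι → Set Ω} {c : ℝ} (h : ∀ i ∈ S, P.real (B i) ≤ c) :
    P.real {ω | ∃ i ∈ S, ω ∈ B i} ≤ S.card * c := by
  have e : {ω | ∃ i ∈ S, ω ∈ B i} = ⋃ i ∈ S, B i := by
    ext ω
    simp
  rw [e, ← nsmul_eq_mul]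
  exact (measureReal_biUnion_finset_le S B).trans (Finset.sum_le_card_nsmul S _ c h)

theorem measureReal_iUnion_le_of_geometric {Ω : Type*} [MeasurableSpace Ω] {P : Measure Ω}
    [IsProbabilityMeasure P] {B : ℕ → Set Ω} {c : ℝ} (hc : 0 ≤ c)
    (h : ∀ k, P.real (B k) ≤ c / 2 / 2 ^ k) : P.real (⋃ k, B k) ≤ c := by
  refine ENNReal.toReal_le_of_le_ofReal hc ((measure_iUnion_le B).trans ?_)
  calc ∑' k, P (B k) ≤ ∑' k, ENNReal.ofReal (c / 2 / 2 ^ k) := by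
        refine ENNReal.tsum_le_tsum fun k => ?_
        rw [← ofReal_measureReal]
        exact ENNReal.ofReal_le_ofReal (h k)
    _ = ENNReal.ofReal (∑' k : ℕ, c / 2 / 2 ^ k) :=
        (ENNReal.ofReal_tsum_of_nonneg (fun k => by positivity) (summable_geometric_two' c)).symm
    _ = ENNReal.ofReal c := by rw [tsum_geometric_two']

theorem IsAdmissible.card_toFinset_le {E : Type*} {A : Set E} {T : ℕ → Set E}
    (h : IsAdmissible A T) (s : ℕ) : ((h.2.1 s).toFinset.card : ℝ) ≤ Real.exp (2 ^ s) := by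
  have h1 : (h.2.1 s).toFinset.card ≤ 2 ^ 2 ^ s := by
    rw [← ncard_eq_toFinset_card (T s) (h.2.1 s)]
    rcases s.eq_zero_or_pos with rfl | hs
    · rw [h.2.2.2.1]
      norm_num
    · exact h.2.2.2.2 s hs
  calc ((h.2.1 s).toFinset.card : ℝ) ≤ (2 : ℝ) ^ 2 ^ s := by exact_mod_cast h1
    _ ≤ Real.exp 1 ^ 2 ^ s := pow_le_pow_left₀ zero_le_two
        (by linarith [Real.exp_one_gt_d9]) _
    _ = Real.exp (2 ^ s) := by
      rw [← Real.exp_nat_mul]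
      simp

theorem card_Icc_neg_natCast (J : ℕ) : ((Finset.Icc (-(J : ℤ)) J).card : ℝ) = 2 * J + 1 := by
  rw [Int.card_Icc]
  have : ((J : ℤ) + 1 - -(J : ℤ)).toNat = 2 * J + 1 := by omega
  rw [this]
  push_cast
  ring

namespace SubexpFamily

variable {𝒳 E : Type*} [MeasurableSpace 𝒳] {μ : Measure 𝒳} [IsProbabilityMeasure μ]
  {A : Set E} {φ : E → 𝒳 → ℝ} {ρ : E → E → ℝ} {D : ℝ}

theorem pi_real_bad_start (H : SubexpFamily μ A φ ρ D) {m J : ℕ} {L ε δ : ℝ} (hε0 : 0 < ε)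
    (hε1 : ε < 1) (hJ : 2 * (J : ℝ) + 1 ≤ Real.exp L) {T : ℕ → Set E} (hT : IsAdmissible A T)
    (s₀ : ℕ) :
    (Measure.pi fun _ : Fin m => μ).real {ω | ∃ a ∈ T s₀, ∃ j : ℤ, |j| ≤ J ∧
      ε * m / 8 < |∑ i, stepFn (j * δ) (φ a (ω i)) - m * cdfOf μ (φ a) (j * δ)|} ≤
      2 * Real.exp (2 ^ s₀ + L - ε ^ 2 * m / 256) := by
  refine (measureReal_mono (fun ω hω => ?_)).trans ((measureReal_exists_mem_le
    ((hT.2.1 s₀).toFinset ×ˢ Finset.Icc (-(J : ℤ)) J)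
    (B := fun i => {ω | ε * m / 8 <
      |∑ k, stepFn (i.2 * δ) (φ i.1 (ω k)) - m * cdfOf μ (φ i.1) (i.2 * δ)|})
    (c := 2 * Real.exp (-(ε ^ 2 * m / 256))) (fun i _ => ?_)).trans ?_)
  · obtain ⟨a, ha, j, hj, hd⟩ := hω
    exact ⟨(a, j), by simpa [ha] using abs_le.1 hj, hd⟩
  · refine (H.pi_real_single i.1 (i.2 * δ) (l := ε / 16) (by linarith) (by linarith)
      (ε * m / 8)).trans (le_of_eq ?_)
    congr 2
    ring
  · rw [Finset.card_product, Nat.cast_mul, card_Icc_neg_natCast]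
    calc _ ≤ Real.exp (2 ^ s₀) * Real.exp L * (2 * Real.exp (-(ε ^ 2 * m / 256))) := by
          gcongr
          exact hT.card_toFinset_le s₀
      _ = _ := by
        rw [sub_eq_add_neg, Real.exp_add, Real.exp_add]
        ring

theorem pi_real_bad_increment (H : SubexpFamily μ A φ ρ D) (hD : 0 ≤ D) {m J : ℕ} {L q δ : ℝ}
    (hL : 0 < L) (hq : 0 < q) (hJ : 2 * (J : ℝ) + 1 ≤ Real.exp L) {T : ℕ → Set E}
    (hT : IsAdmissible A T) {s : ℕ} (hsq : (2 : ℝ) ^ s ≤ q) (hLs : L ≤ 2 ^ s) :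
    (Measure.pi fun _ : Fin m => μ).real {ω | ∃ a ∈ T (s + 1), ∃ b ∈ T s, ∃ j : ℤ, |j| ≤ J ∧
      2 ^ s / q * (16 * D * L * ρ a b + 12 * Real.exp (-L)) * m + 8 * 2 ^ s / (2 ^ s / q) <
      |∑ i, (stepFn (j * δ) (φ a (ω i)) - stepFn (j * δ) (φ b (ω i))) -
        m * (cdfOf μ (φ a) (j * δ) - cdfOf μ (φ b) (j * δ))|} ≤
      2 * Real.exp (-(4 * 2 ^ s)) := by
  refine (measureReal_mono (fun ω hω => ?_)).trans ((measureReal_exists_mem_le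
    (((hT.2.1 (s + 1)).toFinset ×ˢ (hT.2.1 s).toFinset) ×ˢ Finset.Icc (-(J : ℤ)) J)
    (B := fun i => {ω | 2 ^ s / q * (16 * D * L * ρ i.1.1 i.1.2 + 12 * Real.exp (-L)) * m +
      8 * 2 ^ s / (2 ^ s / q) < |∑ k, (stepFn (i.2 * δ) (φ i.1.1 (ω k)) -
        stepFn (i.2 * δ) (φ i.1.2 (ω k))) -
        m * (cdfOf μ (φ i.1.1) (i.2 * δ) - cdfOf μ (φ i.1.2) (i.2 * δ))|})
    (c := 2 * Real.exp (-(8 * 2 ^ s))) (fun i hi => ?_)).trans ?_)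
  · obtain ⟨a, ha, b, hb, j, hj, hd⟩ := hω
    exact ⟨((a, b), j), by simpa [ha, hb] using abs_le.1 hj, hd⟩
  · simp only [Finset.mem_product, Finite.mem_toFinset] at hi
    exact H.pi_real_increment hD i.1.1 (hT.1 s hi.1.2) (i.2 * δ) hL (by positivity)
      ((div_le_one hq).2 hsq) _
  · rw [Finset.card_product, Finset.card_product, Nat.cast_mul, Nat.cast_mul,
      card_Icc_neg_natCast]
    calc _ ≤ Real.exp (2 ^ (s + 1)) * Real.exp (2 ^ s) * Real.exp (2 ^ s) *
          (2 * Real.exp (-(8 * 2 ^ s))) := by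
          gcongr
          · exact hT.card_toFinset_le (s + 1)
          · exact hT.card_toFinset_le s
          · exact hJ.trans (Real.exp_le_exp.2 hLs)
      _ = 2 * Real.exp (2 ^ (s + 1) + 2 ^ s + 2 ^ s + -(8 * 2 ^ s)) := by
        rw [Real.exp_add, Real.exp_add, Real.exp_add]
        ring
      _ = _ := by
        congr 2
        ring

theorem pi_real_bad_excess (H : SubexpFamily μ A φ ρ D) {m : ℕ} {L : ℝ} {T : ℕ → Set E}
    (hT : IsAdmissible A T) {s : ℕ} (hmL : m * (12 * Real.exp (-L)) ≤ 8 * 2 ^ s) :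
    (Measure.pi fun _ : Fin m => μ).real {ω | ∃ a ∈ T (s + 1), ∃ b ∈ T s,
      2 * (8 * 2 ^ s) * (8 * ρ a b) <
        ∑ i, max (|φ a (ω i) - φ b (ω i)| - 8 * L * ρ a b) 0} ≤ Real.exp (-(4 * 2 ^ s)) := by
  refine (measureReal_mono (fun ω hω => ?_)).trans ((measureReal_exists_mem_le
    ((hT.2.1 (s + 1)).toFinset ×ˢ (hT.2.1 s).toFinset)
    (B := fun i => {ω | 2 * (8 * 2 ^ s) * (8 * ρ i.1 i.2) <
        ∑ k, max (|φ i.1 (ω k) - φ i.2 (ω k)| - 8 * L * ρ i.1 i.2) 0})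
    (c := Real.exp (-(8 * 2 ^ s))) (fun i hi => ?_)).trans ?_)
  · obtain ⟨a, ha, b, hb, hd⟩ := hω
    exact ⟨(a, b), by simp [ha, hb], hd⟩
  · exact H.pi_real_excess i.1 i.2 hmL
  · rw [Finset.card_product, Nat.cast_mul]
    calc _ ≤ Real.exp (2 ^ (s + 1)) * Real.exp (2 ^ s) * Real.exp (-(8 * 2 ^ s)) := by
          gcongr
          · exact hT.card_toFinset_le (s + 1)
          · exact hT.card_toFinset_le s
      _ = Real.exp (2 ^ (s + 1) + 2 ^ s + -(8 * 2 ^ s)) := by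
        rw [Real.exp_add, Real.exp_add]
      _ ≤ _ := by
        refine Real.exp_le_exp.2 ?_
        have : (0 : ℝ) < 2 ^ s := by positivity
        rw [pow_succ]
        linarith

/-- The deterministic part of the chaining argument. -/
theorem abs_empCDF_sub_le_of_chain (H : SubexpFamily μ A φ ρ D) (hD : 1 ≤ D) {m : ℕ}
    (hm : 0 < m) {γ ε L q δ : ℝ} (hγ : 1 ≤ γ) (hε0 : 0 < ε) (hε1 : ε < 1) (hL : 1 ≤ L)
    (hexp : m * Real.exp (-L) ≤ γ) (hS : 10 ^ 7 * D * γ * L ^ 2 ≤ ε ^ 2 * m)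
    (hq : q = 4096 * D * L * γ / ε) (hδ : δ = ε / (16 * D)) {J : ℕ} (hJ : 1536 / ε < J * δ)
    {T : ℕ → Set E} (hT : IsAdmissible A T) {x : E} (hx : x ∈ A) {p : ℕ → E}
    (hp : ∀ s, p s ∈ T s)
    (hsum : ∀ n, ∑ s ∈ Finset.range n, (2 : ℝ) ^ s * ρ x (p s) ≤ 2 * γ)
    {s₀ s₁ : ℕ} (h01 : s₀ ≤ s₁) (hlam : ∑ s ∈ Finset.Ico s₀ s₁, (2 : ℝ) ^ s / q ≤ 2)
    (hlev : (s₁ : ℝ) - s₀ ≤ 2 * L) (h1 : q ≤ 2 ^ s₁) {ω : Fin m → 𝒳}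
    (hstart : ∀ a ∈ T s₀, ∀ j : ℤ, |j| ≤ J →
      |∑ i, stepFn (j * δ) (φ a (ω i)) - m * cdfOf μ (φ a) (j * δ)| ≤ ε * m / 8)
    (hinc : ∀ s, s₀ ≤ s → s < s₁ → ∀ a ∈ T (s + 1), ∀ b ∈ T s, ∀ j : ℤ, |j| ≤ J →
      |∑ i, (stepFn (j * δ) (φ a (ω i)) - stepFn (j * δ) (φ b (ω i))) -
        m * (cdfOf μ (φ a) (j * δ) - cdfOf μ (φ b) (j * δ))| ≤
      2 ^ s / q * (16 * D * L * ρ a b + 12 * Real.exp (-L)) * m + 8 * 2 ^ s / (2 ^ s / q))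
    (hexc : ∀ s, s₀ ≤ s → ∀ a ∈ T (s + 1), ∀ b ∈ T s,
      ∑ i, max (|φ a (ω i) - φ b (ω i)| - 8 * L * ρ a b) 0 ≤
        2 * (8 * 2 ^ s) * (8 * ρ a b)) (t : ℝ) :
    |empCDF (fun i => φ x (ω i)) t - cdfOf μ (φ x) t| ≤ ε := by
  have hm0 : (0 : ℝ) < m := Nat.cast_pos.2 hm
  refine H.abs_empCDF_sub_le (by linarith) hx (hT.1 s₁ (hp s₁)) hε0 hδ hJ ?_
    (H.chain_measureReal_le hD hm hγ hε0 hε1 hL hexp hS hq hδ hsum h1) (fun j hj => ?_) t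
  · rw [div_le_iff₀ hm0]
    refine (H.chain_card_le hD hγ hε0 hL hS hq hδ hsum h1 (ω := ω) fun s hs =>
      hexc s (h01.trans hs) _ (hp _) _ (hp _)).trans (le_of_eq ?_)
    ring
  · have := H.chain_deviation_le hD hγ hε0 hε1 hL hexp hS hq hsum h01 hlam hlev
      (hstart _ (hp _) j hj) fun s hs hs1 => hinc s hs hs1 _ (hp _) _ (hp _) j hj
    rw [sum_stepFn hm, ← mul_sub, abs_mul, abs_of_pos hm0] at this
    refine le_of_mul_le_mul_left (this.trans (le_of_eq ?_)) hm0
    ring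

end SubexpFamily

/-- The choice of the first and last level of the chaining argument. -/
theorem exists_chain_levels {D γ L ε m q : ℝ} (hD : 1 ≤ D) (hγ : 1 ≤ γ) (hε0 : 0 < ε)
    (hε1 : ε < 1) (hL : 1 ≤ L) (hexp : m = γ * Real.exp (L - 1))
    (hS : 10 ^ 7 * D * γ * L ^ 2 ≤ ε ^ 2 * m) (hq : q = 4096 * D * L * γ / ε) :
    ∃ s₀ s₁ : ℕ, (2 : ℝ) ^ s₀ ≤ ε ^ 2 * m / 1024 ∧ ε ^ 2 * m / 1024 < 2 * 2 ^ s₀ ∧ s₀ ≤ s₁ ∧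
      (∀ s, s₀ ≤ s → s < s₁ → (2 : ℝ) ^ s ≤ q) ∧
      ∑ s ∈ Finset.Ico s₀ s₁, (2 : ℝ) ^ s / q ≤ 2 ∧ (s₁ : ℝ) - s₀ ≤ 2 * L ∧ q ≤ 2 ^ s₁ := by
  have hDγ : 1 ≤ D * γ := one_le_mul_of_one_le_of_one_le hD hγ
  have hDγL : 1 ≤ D * γ * L := one_le_mul_of_one_le_of_one_le hDγ hL
  have hDγL2 : 1 ≤ D * γ * L * L := one_le_mul_of_one_le_of_one_le hDγL hL
  have hq1 : 1 ≤ q := by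
    rw [hq, le_div_iff₀ hε0]
    nlinarith
  have hS1 : 1 ≤ ε ^ 2 * m / 1024 := by nlinarith
  obtain ⟨s₀, h0, h0'⟩ := exists_nat_pow_near hS1 one_lt_two
  rw [pow_succ (2 : ℝ), mul_comm ((2 : ℝ) ^ s₀)] at h0'
  obtain ⟨P, hP, hP'⟩ := exists_nat_pow_near hq1 one_lt_two
  refine ⟨s₀, max s₀ (P + 1), h0, h0', le_max_left _ _,
    fun s hs hs1 => ?_, ?_, ?_, hP'.le.trans (pow_le_pow_right₀ one_le_two (le_max_right _ _))⟩
  · exact (pow_le_pow_right₀ one_le_two (by omega)).trans hP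
  · rcases le_total (P + 1) s₀ with h | h
    · simp [max_eq_left h]
    · rw [max_eq_right h, ← Finset.sum_div, div_le_iff₀ (by linarith)]
      calc ∑ s ∈ Finset.Ico s₀ (P + 1), (2 : ℝ) ^ s
          ≤ ∑ s ∈ Finset.range (P + 1), (2 : ℝ) ^ s := by
            refine Finset.sum_le_sum_of_subset_of_nonneg (fun s hs => ?_)
              (fun _ _ _ => by positivity)
            rw [Finset.mem_Ico] at hs
            exact Finset.mem_range.2 hs.2
        _ = 2 ^ (P + 1) - 1 := by
            rw [geom_sum_eq (by norm_num)]
            norm_num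
        _ ≤ 2 * q := by
            rw [pow_succ]
            linarith
  · rcases le_or_gt (P + 1) s₀ with h | h
    · rw [max_eq_left h]
      linarith
    · obtain ⟨k, rfl⟩ := Nat.exists_eq_add_of_le (Nat.lt_succ_iff.1 h)
      rw [max_eq_right h.le]
      have hk : (2 : ℝ) ^ k ≤ Real.exp (L - 1) := by
        have hW : (0 : ℝ) < 2 ^ k := by positivity
        have h1 : 2 ^ k * 2 ^ s₀ * ε ≤ 4096 * (D * γ * L) := by
          rw [hq, le_div_iff₀ hε0, pow_add] at hP
          linarith
        have h2 : 10 ^ 7 * (D * γ * L) * L ≤ 2048 * 2 ^ s₀ := by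
          linarith
        have h3 : 2 ^ k * ε ≤ 1 := by
          have h4 : (2 ^ k * ε) * (10 ^ 7 * (D * γ * L) * L) ≤
              (2 ^ k * ε) * (2048 * 2 ^ s₀) := by gcongr
          have h5 : (2 ^ k * ε * L) * (10 ^ 7 * (D * γ * L)) ≤ 1 * (10 ^ 7 * (D * γ * L)) := by
            linarith
          have h6 := le_of_mul_le_mul_right h5 (by positivity)
          nlinarith [mul_pos hW hε0]
        have hm0 : 0 ≤ m := by
          rw [hexp]
          positivity
        have h7 : γ ≤ ε ^ 2 * m := by nlinarith
        have h8 : 2 ^ k * γ ≤ γ * Real.exp (L - 1) := by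
          calc 2 ^ k * γ ≤ 2 ^ k * (ε ^ 2 * m) := by gcongr
            _ = (2 ^ k * ε) * (ε * m) := by ring
            _ ≤ 1 * (1 * m) := by gcongr
            _ = _ := by rw [one_mul, one_mul, hexp]
        rw [mul_comm] at h8
        exact le_of_mul_le_mul_left h8 (by linarith)
      have hlog := Real.log_le_log (by positivity) hk
      rw [Real.log_exp, Real.log_pow] at hlog
      have hk0 : (0 : ℝ) ≤ k := Nat.cast_nonneg k
      push_cast
      nlinarith [Real.log_two_gt_d9]

theorem exp_neg_four_mul_two_pow_le (s₀ k : ℕ) :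
    3 * Real.exp (-(4 * 2 ^ (s₀ + k))) ≤ 3 * Real.exp (-(3 * 2 ^ s₀)) / 2 / 2 ^ k := by
  have h1 : Real.exp (-2 ^ k) ≤ (1 / 2) ^ (k + 1) := by
    calc Real.exp (-2 ^ k) ≤ Real.exp (-((k + 1 : ℕ) : ℝ)) := by
          refine Real.exp_le_exp.2 (neg_le_neg ?_)
          exact_mod_cast k.lt_two_pow_self
      _ = (Real.exp (-1)) ^ (k + 1) := by
          rw [← Real.exp_nat_mul]
          congr 1
          ring
      _ ≤ _ := by
          refine pow_le_pow_left₀ (Real.exp_pos _).le ?_ _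
          linarith [Real.exp_neg_one_lt_d9]
  have h2 : (3 : ℝ) * 2 ^ s₀ + 2 ^ k ≤ 4 * 2 ^ (s₀ + k) := by
    have a : (1 : ℝ) ≤ 2 ^ s₀ := one_le_pow₀ one_le_two
    have b : (1 : ℝ) ≤ 2 ^ k := one_le_pow₀ one_le_two
    rw [pow_add]
    nlinarith
  calc 3 * Real.exp (-(4 * 2 ^ (s₀ + k))) ≤ 3 * Real.exp (-(3 * 2 ^ s₀) + -2 ^ k) := by
        gcongr
        linarith
    _ = 3 * Real.exp (-(3 * 2 ^ s₀)) * Real.exp (-2 ^ k) := by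
        rw [Real.exp_add]
        ring
    _ ≤ 3 * Real.exp (-(3 * 2 ^ s₀)) * (1 / 2) ^ (k + 1) := by gcongr
    _ = _ := by
        rw [div_pow, one_pow, pow_succ]
        field_simp

/-- The uniform Dvoretzky–Kiefer–Wolfowitz inequality for families with subexponential
increments and bounded densities. -/
theorem SubexpFamily.uniform_dkw {𝒳 E : Type*} [MeasurableSpace 𝒳] {μ : Measure 𝒳}
    [IsProbabilityMeasure μ] {A : Set E} {φ : E → 𝒳 → ℝ} {ρ : E → E → ℝ} {D : ℝ}
    (H : SubexpFamily μ A φ ρ D) (hD : 1 ≤ D) {m : ℕ} {γ ε L : ℝ} (hγ : 1 ≤ γ) (hε0 : 0 < ε)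
    (hε1 : ε < 1) (hL : 1 ≤ L) (hexp : m = γ * Real.exp (L - 1))
    (hS : 10 ^ 7 * D * γ * L ^ 2 ≤ ε ^ 2 * m) {T : ℕ → Set E} (hT : IsAdmissible A T)
    {p : E → ℕ → E} (hp : ∀ x ∈ A, ∀ s, p x s ∈ T s)
    (hsum : ∀ x ∈ A, ∀ n, ∑ s ∈ Finset.range n, (2 : ℝ) ^ s * ρ x (p x s) ≤ 2 * γ) :
    (Measure.pi fun _ : Fin m => μ).real {ω | ∀ x ∈ A, ∀ t : ℝ,
      |empCDF (fun i => φ x (ω i)) t - cdfOf μ (φ x) t| ≤ ε}ᶜ ≤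
        2 * Real.exp (-(ε ^ 2 * m / 2048)) := by
  have hmpos : (0 : ℝ) < m := by
    rw [hexp]
    positivity
  have hDγ : 1 ≤ D * γ := one_le_mul_of_one_le_of_one_le hD hγ
  have hDγL : 1 ≤ D * γ * L := one_le_mul_of_one_le_of_one_le hDγ hL
  obtain ⟨q, hq⟩ : ∃ q, q = 4096 * D * L * γ / ε := ⟨_, rfl⟩
  obtain ⟨δ, hδ⟩ : ∃ δ, δ = ε / (16 * D) := ⟨_, rfl⟩
  obtain ⟨s₀, s₁, h0, h0', h01, hsq, hlam, hlev, h1⟩ :=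
    exists_chain_levels hD hγ hε0 hε1 hL hexp hS hq
  have hq0 : 0 < q := by
    rw [hq]
    positivity
  have hδ0 : 0 < δ := by
    rw [hδ]
    positivity
  have hexpL : m * Real.exp (-L) ≤ γ := by
    rw [hexp, mul_assoc, ← Real.exp_add]
    refine mul_le_of_le_one_right (by linarith) (Real.exp_le_one_iff.2 (by linarith))
  have hL2 : L ≤ 2 ^ s₀ := by nlinarith
  have hγ2 : m * (12 * Real.exp (-L)) ≤ 8 * 2 ^ s₀ := by nlinarith
  have hmono : ∀ {s}, s₀ ≤ s → (2 : ℝ) ^ s₀ ≤ 2 ^ s := fun h => pow_le_pow_right₀ one_le_two h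
  set J : ℕ := ⌊1536 / ε / δ⌋₊ + 1 with hJdef
  have hJ : 1536 / ε < J * δ := by
    rw [← div_lt_iff₀ hδ0, hJdef]
    exact_mod_cast Nat.lt_floor_add_one (1536 / ε / δ)
  have hJL : 2 * (J : ℝ) + 1 ≤ Real.exp L := by
    have a : (J : ℝ) ≤ 1536 / ε / δ + 1 := by
      rw [hJdef]
      push_cast
      linarith [Nat.floor_le (a := 1536 / ε / δ) (by positivity)]
    have b : 1536 / ε / δ = 24576 * D / ε ^ 2 := by
      rw [hδ]
      field_simp
      ring
    have c : 1 ≤ D / ε ^ 2 := by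
      rw [one_le_div (by positivity)]
      nlinarith
    have d : D / ε ^ 2 * 10 ^ 7 ≤ Real.exp (L - 1) := by
      rw [div_mul_eq_mul_div, div_le_iff₀ (by positivity)]
      have : γ * (D * 10 ^ 7) ≤ γ * (Real.exp (L - 1) * ε ^ 2) := by
        have e : γ * (Real.exp (L - 1) * ε ^ 2) = ε ^ 2 * m := by
          rw [hexp]
          ring
        rw [e]
        nlinarith
      exact le_of_mul_le_mul_left this (by linarith)
    have f : Real.exp (L - 1) ≤ Real.exp L := Real.exp_le_exp.2 (by linarith)
    rw [b, mul_div_assoc] at a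
    linarith
  set P := Measure.pi fun _ : Fin m => μ with hP
  set B₀ : Set (Fin m → 𝒳) := {ω | ∃ a ∈ T s₀, ∃ j : ℤ, |j| ≤ J ∧
    ε * m / 8 < |∑ i, stepFn (j * δ) (φ a (ω i)) - m * cdfOf μ (φ a) (j * δ)|} with hB₀
  set B₁ : ℕ → Set (Fin m → 𝒳) := fun s => {ω | ∃ a ∈ T (s + 1), ∃ b ∈ T s, ∃ j : ℤ,
    |j| ≤ J ∧ 2 ^ s / q * (16 * D * L * ρ a b + 12 * Real.exp (-L)) * m +
      8 * 2 ^ s / (2 ^ s / q) <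
      |∑ i, (stepFn (j * δ) (φ a (ω i)) - stepFn (j * δ) (φ b (ω i))) -
        m * (cdfOf μ (φ a) (j * δ) - cdfOf μ (φ b) (j * δ))|} with hB₁
  set B₂ : ℕ → Set (Fin m → 𝒳) := fun s => {ω | ∃ a ∈ T (s + 1), ∃ b ∈ T s,
    2 * (8 * 2 ^ s) * (8 * ρ a b) <
      ∑ i, max (|φ a (ω i) - φ b (ω i)| - 8 * L * ρ a b) 0} with hB₂
  set B : ℕ → Set (Fin m → 𝒳) := fun k =>
    (if s₀ + k < s₁ then B₁ (s₀ + k) else ∅) ∪ B₂ (s₀ + k) with hB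
  have hBle : ∀ k, P.real (B k) ≤ 3 * Real.exp (-(3 * 2 ^ s₀)) / 2 / 2 ^ k := by
    intro k
    refine le_trans ?_ (exp_neg_four_mul_two_pow_le s₀ k)
    have hk : s₀ ≤ s₀ + k := Nat.le_add_right _ _
    have h2 : P.real (B₂ (s₀ + k)) ≤ Real.exp (-(4 * 2 ^ (s₀ + k))) :=
      H.pi_real_bad_excess hT (by linarith [hmono hk])
    have h1 : P.real (if s₀ + k < s₁ then B₁ (s₀ + k) else ∅) ≤
        2 * Real.exp (-(4 * 2 ^ (s₀ + k))) := by
      split_ifs with hs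
      · exact H.pi_real_bad_increment (by linarith) (by linarith) hq0 hJL hT (hsq _ hk hs)
          (by linarith [hmono hk])
      · rw [measureReal_empty]
        positivity
    linarith [measureReal_union_le (μ := P) (if s₀ + k < s₁ then B₁ (s₀ + k) else ∅)
      (B₂ (s₀ + k))]
  have hB₀le : P.real B₀ ≤ 2 * Real.exp (2 ^ s₀ + L - ε ^ 2 * m / 256) :=
    H.pi_real_bad_start hε0 hε1 hJL hT s₀
  have hUle := measureReal_iUnion_le_of_geometric (P := P) (by positivity) hBle
  have hsub : {ω | ∀ x ∈ A, ∀ t : ℝ,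
      |empCDF (fun i => φ x (ω i)) t - cdfOf μ (φ x) t| ≤ ε}ᶜ ⊆ B₀ ∪ ⋃ k, B k := by
    rw [compl_subset_comm]
    intro ω hω x hx t
    rw [mem_compl_iff, mem_union, not_or] at hω
    obtain ⟨hω0, hωU⟩ := hω
    have hωk : ∀ k, ω ∉ B k := fun k hk => hωU (mem_iUnion.2 ⟨k, hk⟩)
    refine H.abs_empCDF_sub_le_of_chain hD (Nat.cast_pos.1 hmpos) hγ hε0 hε1 hL hexpL hS hq hδ hJ
      hT hx (hp x hx) (hsum x hx) h01 hlam hlev h1 (fun a ha j hj => ?_)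
      (fun s hs hs1 a ha b hb j hj => ?_) (fun s hs a ha b hb => ?_) t
    · exact not_lt.1 fun h => hω0 ⟨a, ha, j, hj, h⟩
    · obtain ⟨k, rfl⟩ := Nat.exists_eq_add_of_le hs
      refine not_lt.1 fun h => hωk k (Or.inl ?_)
      rw [if_pos hs1]
      exact ⟨a, ha, b, hb, j, hj, h⟩
    · obtain ⟨k, rfl⟩ := Nat.exists_eq_add_of_le hs
      exact not_lt.1 fun h => hωk k (Or.inr ⟨a, ha, b, hb, h⟩)
  set S := ε ^ 2 * m with hSdef
  have hSbig : 10 ^ 7 * L ≤ S := by nlinarith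
  have e1 : Real.exp (2 ^ s₀ + L - S / 256) ≤ Real.exp (-(S / 1024)) :=
    Real.exp_le_exp.2 (by linarith)
  have e2 : Real.exp (-(3 * 2 ^ s₀)) ≤ Real.exp (-(S / 1024)) :=
    Real.exp_le_exp.2 (by linarith)
  have e3 : Real.exp (-(S / 1024)) ≤ Real.exp (-(S / 2048)) * (2 / 5) := by
    have : Real.exp (-(S / 1024)) = Real.exp (-(S / 2048)) * Real.exp (-(S / 2048)) := by
      rw [← Real.exp_add]
      congr 1
      ring
    rw [this]
    gcongr
    calc Real.exp (-(S / 2048)) ≤ Real.exp (-1) := Real.exp_le_exp.2 (by linarith)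
      _ ≤ 2 / 5 := by linarith [Real.exp_neg_one_lt_d9]
  linarith [measureReal_mono (μ := P) hsub, measureReal_union_le (μ := P) B₀ (⋃ k, B k)]

theorem euclDist_eq_dist {d : ℕ} (x y : Fin d → ℝ) :
    euclDist x y = dist (WithLp.toLp 2 x) (WithLp.toLp 2 y) := by
  simp [euclDist, EuclideanSpace.dist_eq, Real.dist_eq, sq_abs]

theorem euclDist_zero_right {d : ℕ} {x : Fin d → ℝ} (hx : x ∈ unitSphere d) :
    euclDist x 0 = 1 := by
  have : ∑ i, x i ^ 2 = 1 := hx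
  simp [euclDist, this]

/-- Linear functionals of an isotropic log-concave random vector. -/
theorem IsLogConcave.subexpFamily_dotp {d : ℕ} {μ : Measure (Fin d → ℝ)} [IsProbabilityMeasure μ]
    {f : (Fin d → ℝ) → ℝ} (hf0 : ∀ v, 0 ≤ f v) (hf : IsLogConcave f)
    (hμ : μ = volume.withDensity fun v => ENNReal.ofReal (f v))
    (hmean : ∀ i, ∫ v, v i ∂μ = 0)
    (hcov : ∀ i j, ∫ v, v i * v j ∂μ = if i = j then (1 : ℝ) else 0)
    {A : Set (Fin d → ℝ)} (hA : A ⊆ unitSphere d) :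
    SubexpFamily μ A (fun x v => dotp v x) euclDist 603979776 := by
  have hmeas : ∀ x y : Fin d → ℝ,
      Measurable fun v => Real.exp (|dotp v x - dotp v y| / (8 * euclDist x y)) := fun x y =>
    (((measurable_dotp x).sub (measurable_dotp y)).abs.div_const _).exp
  have hint : ∀ x y : Fin d → ℝ, 0 < euclDist x y →
      Integrable (fun v => Real.exp (|dotp v x - dotp v y| / (8 * euclDist x y))) μ := by
    intro x y hxy
    refine ⟨(hmeas x y).aestronglyMeasurable, ?_⟩
    rw [hasFiniteIntegral_iff_ofReal (ae_of_all _ fun v => (Real.exp_pos _).le)]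
    exact (hf.lintegral_exp_dotp_le hf0 hμ hcov hxy).trans_lt ENNReal.ofReal_lt_top
  have hle : ∀ x y : Fin d → ℝ, 0 < euclDist x y →
      ∫ v, Real.exp (|dotp v x - dotp v y| / (8 * euclDist x y)) ∂μ ≤ 12 := by
    intro x y hxy
    rw [integral_eq_lintegral_of_nonneg_ae (ae_of_all _ fun v => (Real.exp_pos _).le)
      (hmeas x y).aestronglyMeasurable]
    exact ENNReal.toReal_le_of_le_ofReal (by norm_num) (hf.lintegral_exp_dotp_le hf0 hμ hcov hxy)
  have hz : ∀ v : Fin d → ℝ, dotp v 0 = 0 := fun v => by simp [dotp]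
  refine ⟨measurable_dotp, hint, hle, fun x hx => ?_, fun x hx => ?_,
    fun x hx t h hh => hf.small_ball hf0 hμ hmean hcov (hA hx) t h hh,
    fun v => ⟨√(∑ i, v i ^ 2), by positivity, abs_dotp_sub_le v⟩,
    fun x y => Real.sqrt_nonneg _, fun x y => ?_, fun x y z => ?_⟩
  · have h1 := euclDist_zero_right (hA hx)
    simpa [h1, hz] using hint x 0 (by rw [h1]; exact one_pos)
  · have h1 := euclDist_zero_right (hA hx)
    simpa [h1, hz] using hle x 0 (by rw [h1]; exact one_pos)
  · simp only [euclDist_eq_dist, dist_comm]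
  · simp only [euclDist_eq_dist]
    exact dist_triangle _ _ _

/-- Admissible sequences that are optimal for `γ₁` up to a factor of two. -/
theorem exists_admissible_of_gamma1_pos {E : Type*} {ρ : E → E → ℝ} {A : Set E}
    (h : 0 < gamma1 ρ A) : ∃ (T : ℕ → Set E) (p : E → ℕ → E), IsAdmissible A T ∧
      (∀ x s, p x s ∈ T s) ∧
      ∀ x ∈ A, ∀ n, ∑ s ∈ Finset.range n, (2 : ℝ) ^ s * ρ x (p x s) ≤ 2 * gamma1 ρ A := by
  set R := {r : ℝ | ∃ T : ℕ → Set E, IsAdmissible A T ∧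
    ∀ h ∈ A, ∀ n : ℕ, ∑ s ∈ Finset.range n, (2 : ℝ) ^ s * sInf (ρ h '' T s) ≤ r} with hR
  have hg : gamma1 ρ A = sInf R := rfl
  have hne : R.Nonempty := by
    by_contra hn
    rw [not_nonempty_iff_eq_empty] at hn
    rw [hg, hn, Real.sInf_empty] at h
    exact lt_irrefl _ h
  obtain ⟨r, ⟨T, hT, hr⟩, hlt⟩ := exists_lt_of_csInf_lt hne
    (show sInf R < 2 * gamma1 ρ A by rw [← hg]; linarith)
  have hmin : ∀ x s, ∃ y ∈ T s, ρ x y = sInf (ρ x '' T s) := fun x s =>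
    ((hT.2.2.1 s).image _).csInf_mem ((hT.2.1 s).image _)
  choose p hp hpe using hmin
  refine ⟨T, p, hT, hp, fun x hx n => ?_⟩
  simp only [hpe]
  exact (hr x hx n).trans hlt.le
/-- **Corollary 1.10**: the uniform DKW inequality for isotropic log-concave random
vectors in `ℝ^d` and classes of linear functionals indexed by `A ⊆ S^{d-1}`. -/
theorem logconcave_uniform_DKW :
    ∃ c₁ c₂ : ℝ, 0 < c₁ ∧ 0 < c₂ ∧
      ∀ (d : ℕ) (μ : Measure (Fin d → ℝ)) [IsProbabilityMeasure μ],
        -- `X ∼ μ` is isotropic: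
        (∀ i, ∫ v, v i ∂μ = 0) →
        (∀ i j, ∫ v, v i * v j ∂μ = if i = j then (1 : ℝ) else 0) →
        -- `X ∼ μ` has a log-concave density:
        (∃ f : (Fin d → ℝ) → ℝ, (∀ v, 0 ≤ f v) ∧ IsLogConcave f ∧
          μ = (volume : Measure (Fin d → ℝ)).withDensity fun v => ENNReal.ofReal (f v)) →
        ∀ (A : Set (Fin d → ℝ)) (m : ℕ) (Δ : ℝ),
          A ⊆ unitSphere d →
          1 ≤ gamma1 euclDist A →
          gamma1 euclDist A ≤ m →
          c₁ * (gamma1 euclDist A / m) *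
              (Real.log (Real.exp 1 * m / gamma1 euclDist A)) ^ 2 ≤ Δ →
          ENNReal.ofReal (1 - 2 * Real.exp (-c₂ * Δ * m)) ≤
            (Measure.pi fun _ : Fin m => μ)
              {ω | ∀ x ∈ A, ∀ t : ℝ,
                |empCDF (fun i => dotp (ω i) x) t - cdfOf μ (fun v => dotp v x) t| ≤
                  Real.sqrt Δ} := by

  refine ⟨10 ^ 7 * 603979776, 1 / 2048, by norm_num, by norm_num, ?_⟩
  intro d μ _ hmean hcov ⟨f, hf0, hf, hμ⟩ A m Δ hA hγ hγm hΔ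
  set γ := gamma1 euclDist A with hγdef
  have hγ0 : 0 < γ := by linarith
  have hm0 : (0 : ℝ) < m := by linarith
  rcases le_or_gt 1 Δ with h1 | h1
  · have huniv : {ω : Fin m → Fin d → ℝ | ∀ x ∈ A, ∀ t : ℝ,
        |empCDF (fun i => dotp (ω i) x) t - cdfOf μ (fun v => dotp v x) t| ≤ √Δ} = univ := by
      refine eq_univ_of_forall fun ω x _ t => (abs_le.2 ⟨?_, ?_⟩).trans (Real.one_le_sqrt.2 h1)
      · linarith [empCDF_nonneg (fun i => dotp (ω i) x) t,
          cdfOf_le_one (μ := μ) (fun v => dotp v x) t]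
      · linarith [empCDF_le_one (fun i => dotp (ω i) x) t,
          cdfOf_nonneg (μ := μ) (fun v => dotp v x) t]
    rw [huniv, measure_univ, ENNReal.ofReal_le_one]
    linarith [Real.exp_pos (-(1 / 2048) * Δ * m)]
  · set L := Real.log (Real.exp 1 * m / γ) with hLdef
    have hexpL : Real.exp L = Real.exp 1 * m / γ := Real.exp_log (by positivity)
    have hexp : (m : ℝ) = γ * Real.exp (L - 1) := by
      rw [Real.exp_sub, hexpL]
      field_simp
    have hL : 1 ≤ L := by
      rw [hLdef, Real.le_log_iff_exp_le (by positivity), mul_div_assoc]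
      exact le_mul_of_one_le_right (Real.exp_pos 1).le ((one_le_div hγ0).2 hγm)
    have hS : 10 ^ 7 * 603979776 * γ * L ^ 2 ≤ Δ * m := by
      have := mul_le_mul_of_nonneg_right hΔ hm0.le
      refine le_trans (le_of_eq ?_) this
      field_simp
    have hΔ0 : 0 < Δ := by
      refine pos_of_mul_pos_left (lt_of_lt_of_le ?_ hS) hm0.le
      positivity
    have hsq : √Δ ^ 2 = Δ := Real.sq_sqrt hΔ0.le
    obtain ⟨T, p, hT, hp, hsum⟩ := exists_admissible_of_gamma1_pos (ρ := euclDist) (A := A) hγ0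
    have hbad := (hf.subexpFamily_dotp hf0 hμ hmean hcov hA).uniform_dkw (by norm_num) hγ
      (Real.sqrt_pos.2 hΔ0) ((Real.sqrt_lt' one_pos).2 (by simpa using h1)) hL hexp
      (by rwa [hsq]) hT (fun x _ => hp x) hsum
    set G : Set (Fin m → Fin d → ℝ) := {ω | ∀ x ∈ A, ∀ t : ℝ,
      |empCDF (fun i => dotp (ω i) x) t - cdfOf μ (fun v => dotp v x) t| ≤ √Δ} with hG
    rw [hsq] at hbad
    refine ENNReal.ofReal_le_of_le_toReal ?_
    have hun := measureReal_union_le (μ := Measure.pi fun _ : Fin m => μ) G Gᶜ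
    rw [union_compl_self, probReal_univ] at hun
    have he : -(1 / 2048) * Δ * m = -(Δ * m / 2048) := by ring
    rw [he]
    change _ ≤ (Measure.pi fun _ : Fin m => μ).real G
    linarith
end
end

section
/- Let w be a symmetric random variable with variance 1 satisfying ℙ(|w| ≥ 0.1) ≥ 0.1, and suppose that w does not have a subexponential tail decay, in the quantitative sense that for every L ≥ 1 there exists t > 20 with ℙ(w ≤ −t) ≥ exp(−t/L). Then for every m ≥ 231 there exist d ∈ ℕ and a set A ⊂ S^{d−1} satisfying γ₁(A) ≤ 10 such that, with X the random vector in ℝ^d whose coordinates are independent copies of w and X₁,…,X_m independent copies of X, ℙ( sup_{x∈A} ‖F_{m,x} − F_x‖_{L∞} ≥ 1/10 ) ≥ 0.9. -/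
open MeasureTheory Real Set

noncomputable section

theorem euclDist_self {d : ℕ} (x : Fin d → ℝ) : euclDist x x = 0 := by
  simp [euclDist]

theorem euclDist_nonneg {d : ℕ} (x y : Fin d → ℝ) : 0 ≤ euclDist x y :=
  Real.sqrt_nonneg _

theorem sum_range_ite_two_pow_mul_le {δ : ℝ} (hδ : 0 ≤ δ) (k n : ℕ) :
    ∑ s ∈ Finset.range n, (2 : ℝ) ^ s * (if s < k then δ else 0) ≤ 2 ^ k * δ := by
  have key : ∑ s ∈ Finset.range n, (2 : ℝ) ^ s * (if s < k then δ else 0) ≤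
      2 ^ (min n k) * δ := by
    induction n with
    | zero => simpa using hδ
    | succ n ih =>
      rw [Finset.sum_range_succ]
      by_cases h : n < k
      · rw [min_eq_left h.le] at ih
        rw [min_eq_left (Nat.succ_le_of_lt h), if_pos h, pow_succ]
        linarith
      · rw [min_eq_right (not_lt.1 h)] at ih
        rw [min_eq_right ((not_lt.1 h).trans n.le_succ), if_neg h]
        linarith
  refine key.trans (mul_le_mul_of_nonneg_right ?_ hδ)
  exact pow_le_pow_right₀ one_le_two (min_le_right _ _)

/-- A finite set of diameter at most `δ` with at most `2 ^ 2 ^ k` elements satisfies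
`γ₁ ≤ 2 ^ k * δ`. -/
theorem gamma1_euclDist_le {d : ℕ} {A : Set (Fin d → ℝ)} (hfin : A.Finite) (hne : A.Nonempty)
    {k : ℕ} (hk : 1 ≤ k) (hcard : A.ncard ≤ 2 ^ 2 ^ k) {δ : ℝ}
    (hδ : ∀ x ∈ A, ∀ y ∈ A, euclDist x y ≤ δ) :
    gamma1 euclDist A ≤ 2 ^ k * δ := by
  obtain ⟨a, ha⟩ := hne
  have hδ0 : 0 ≤ δ := (euclDist_nonneg a a).trans (hδ a ha a ha)
  refine csInf_le ⟨0, ?_⟩ ⟨fun s => if s < k then {a} else A, ⟨?_, ?_, ?_, ?_, ?_⟩, ?_⟩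
  · rintro r ⟨T, -, hr⟩
    simpa using hr a ha 0
  · intro s
    dsimp only
    split_ifs
    · simpa using ha
    · exact Subset.rfl
  · intro s
    dsimp only
    split_ifs
    · exact Set.finite_singleton a
    · exact hfin
  · intro s
    dsimp only
    split_ifs
    · exact Set.singleton_nonempty a
    · exact ⟨a, ha⟩
  · simp [Nat.lt_of_succ_le hk]
  · intro s hs
    dsimp only
    split_ifs with h
    · simpa using Nat.one_le_two_pow
    · exact hcard.trans (Nat.pow_le_pow_right two_pos
        (Nat.pow_le_pow_right two_pos (not_lt.1 h)))
  · intro x hx n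
    refine le_trans (Finset.sum_le_sum fun s _ => ?_) (sum_range_ite_two_pow_mul_le hδ0 k n)
    refine mul_le_mul_of_nonneg_left ?_ (by positivity)
    by_cases h : s < k
    · simpa [h] using hδ x hx a ha
    · simp only [if_neg h]
      refine csInf_le ⟨0, ?_⟩ ⟨x, hx, euclDist_self x⟩
      rintro _ ⟨y, -, rfl⟩
      exact euclDist_nonneg x y

/-- Transposing a matrix with iid entries preserves its distribution. -/
theorem map_transpose_pi_pi (ν : Measure ℝ) [IsProbabilityMeasure ν] (ι κ : Type*) [Fintype ι]
    [Fintype κ] :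
    (Measure.pi fun _ : ι => Measure.pi fun _ : κ => ν).map (fun ω j i => ω i j) =
      Measure.pi fun _ : κ => Measure.pi fun _ : ι => ν := by
  have h1 := Measure.infinitePi_map_curry (fun (_ : ι) (_ : κ) => ν)
  have h2 := Measure.infinitePi_map_curry (fun (_ : κ) (_ : ι) => ν)
  simp only [Measure.infinitePi_eq_pi] at h1 h2
  have h3 : (Measure.pi fun _ : ι × κ => ν).map (fun f (p : κ × ι) => f p.swap) =
      Measure.pi fun _ : κ × ι => ν := by
    symm
    refine Measure.pi_eq fun s hs => ?_
    rw [Measure.map_apply (by fun_prop) (MeasurableSet.univ_pi hs)]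
    have : (fun (f : ι × κ → ℝ) (p : κ × ι) => f p.swap) ⁻¹' (Set.univ.pi s) =
        Set.univ.pi fun p => s p.swap := by
      ext f
      simp only [Set.mem_preimage, Set.mem_univ_pi, Prod.forall, Prod.swap_prod_mk]
      exact forall_comm
    rw [this, Measure.pi_pi]
    exact Fintype.prod_equiv (Equiv.prodComm ι κ) _ _ fun _ => rfl
  rw [← h1, ← h2, ← h3, Measure.map_map (by fun_prop) (by fun_prop),
    Measure.map_map (by fun_prop) (by fun_prop)]
  rfl

theorem pi_pi_forall_exists_notMem (ν : Measure ℝ) [IsProbabilityMeasure ν] (m N : ℕ)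
    {S : Set ℝ} (hS : MeasurableSet S) :
    (Measure.pi fun _ : Fin m => Measure.pi fun _ : Fin (N + 1) => ν)
      {ω | ∀ j : Fin N, ∃ i, ω i j.succ ∉ S} = (1 - ν S ^ m) ^ N := by
  set B : Set (Fin m → ℝ) := (Set.univ.pi fun _ => S)ᶜ with hB
  have hBm : MeasurableSet B := (MeasurableSet.univ_pi fun _ => hS).compl
  have hset : {ω : Fin m → Fin (N + 1) → ℝ | ∀ j : Fin N, ∃ i, ω i j.succ ∉ S} =
      (fun (ω : Fin m → Fin (N + 1) → ℝ) j i => ω i j) ⁻¹'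
        (Set.univ.pi (Fin.cons Set.univ fun _ => B : Fin (N + 1) → Set (Fin m → ℝ))) := by
    ext ω
    simp [hB, Fin.forall_fin_succ]
  have hm : ∀ j, MeasurableSet
      ((Fin.cons Set.univ fun _ => B : Fin (N + 1) → Set (Fin m → ℝ)) j) := by
    intro j
    refine Fin.cases ?_ (fun j => ?_) j
    · simp
    · simpa using hBm
  rw [hset, ← Measure.map_apply (by fun_prop) (MeasurableSet.univ_pi hm), map_transpose_pi_pi,
    Measure.pi_pi, Fin.prod_univ_succ]
  simp only [Fin.cons_zero, measure_univ, one_mul, Fin.cons_succ, Finset.prod_const,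
    Finset.card_univ, Fintype.card_fin]
  rw [hB, prob_compl_eq_one_sub (MeasurableSet.univ_pi fun _ => hS), Measure.pi_pi]
  simp

theorem measure_le_abs_le (ν : Measure ℝ) [IsProbabilityMeasure ν]
    (hvar : (∫ t, t ^ 2 ∂ν) = 1) {R : ℝ} (hR : 0 < R) :
    ν {t | R ≤ |t|} ≤ ENNReal.ofReal (1 / R ^ 2) := by
  have hint : Integrable (fun t : ℝ => t ^ 2) ν := by
    by_contra h
    rw [integral_undef h] at hvar
    exact zero_ne_one hvar
  have h := mul_meas_ge_le_integral_of_nonneg (μ := ν) (f := fun t : ℝ => t ^ 2)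
    (Filter.Eventually.of_forall fun t => sq_nonneg t) hint (R ^ 2)
  rw [hvar] at h
  have hset : {t : ℝ | R ≤ |t|} = {t | R ^ 2 ≤ t ^ 2} := by
    ext t
    simp only [Set.mem_ofPred_eq]
    rw [← sq_abs t]
    exact (pow_le_pow_iff_left₀ hR.le (abs_nonneg t) two_ne_zero).symm
  rw [hset, ← ofReal_measureReal]
  refine ENNReal.ofReal_le_ofReal ?_
  rw [le_div_iff₀ (by positivity)]
  linarith

/-- The vector `a e₀ + b e_{j+1}`. -/
def spike (N : ℕ) (a b : ℝ) (j : Fin N) : Fin (N + 1) → ℝ :=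
  Fin.cons a (Pi.single j b)

theorem dotp_spike {N : ℕ} (a b : ℝ) (j : Fin N) (v : Fin (N + 1) → ℝ) :
    dotp v (spike N a b j) = v 0 * a + v j.succ * b := by
  simp [dotp, spike, Fin.sum_univ_succ, Pi.single_apply]

theorem spike_mem_unitSphere {N : ℕ} {a b : ℝ} (hab : a ^ 2 + b ^ 2 = 1) (j : Fin N) :
    spike N a b j ∈ unitSphere (N + 1) := by
  simpa [unitSphere, spike, Fin.sum_univ_succ, Pi.single_apply, ite_pow] using hab

theorem euclDist_spike_le {N : ℕ} (a : ℝ) {b : ℝ} (hb : 0 ≤ b) (j k : Fin N) :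
    euclDist (spike N a b j) (spike N a b k) ≤ 2 * b := by
  refine Real.sqrt_le_iff.2 ⟨by positivity, ?_⟩
  have h : ∀ i : Fin N, ((Pi.single j b : Fin N → ℝ) i - (Pi.single k b : Fin N → ℝ) i) ^ 2 ≤
      2 * ((if i = j then b ^ 2 else 0) + (if i = k then b ^ 2 else 0)) := by
    intro i
    simp only [Pi.single_apply]
    split_ifs <;> nlinarith [sq_nonneg b]
  rw [Fin.sum_univ_succ]
  simp only [spike, Fin.cons_zero, Fin.cons_succ, sub_self]
  refine (add_le_add_right (Finset.sum_le_sum fun i _ => h i) _).trans ?_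
  rw [← Finset.mul_sum, Finset.sum_add_distrib]
  simp
  linarith

theorem cdfOf_dotp_spike_le (ν : Measure ℝ) [IsProbabilityMeasure ν]
    (hvar : (∫ t, t ^ 2 ∂ν) = 1) {N : ℕ} {a b R : ℝ} (ha : |a| ≤ 1) (hb : |b| ≤ 1)
    (hR : 0 < R) (j : Fin N) :
    cdfOf (Measure.pi fun _ : Fin (N + 1) => ν) (fun v => dotp v (spike N a b j)) (-2 * R) ≤
      2 / R ^ 2 := by
  have hev : ∀ k : Fin (N + 1), (Measure.pi fun _ : Fin (N + 1) => ν) {v | R ≤ |v k|} ≤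
      ENNReal.ofReal (1 / R ^ 2) := by
    intro k
    refine le_of_eq_of_le ?_ (measure_le_abs_le ν hvar hR)
    exact (measurePreserving_eval (fun _ : Fin (N + 1) => ν) k).measure_preimage
      (measurableSet_le measurable_const measurable_id.abs).nullMeasurableSet
  have hsub : {v | dotp v (spike N a b j) ≤ -2 * R} ⊆
      {v : Fin (N + 1) → ℝ | R ≤ |v 0|} ∪ {v | R ≤ |v j.succ|} := by
    intro v hv
    by_contra hcon
    simp only [Set.mem_union, Set.mem_ofPred_eq, not_or, not_le] at hcon
    rw [Set.mem_ofPred_eq, dotp_spike] at hv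
    have h1 : |v 0 * a| ≤ |v 0| := by
      rw [abs_mul]; exact mul_le_of_le_one_right (abs_nonneg _) ha
    have h2 : |v j.succ * b| ≤ |v j.succ| := by
      rw [abs_mul]; exact mul_le_of_le_one_right (abs_nonneg _) hb
    linarith [neg_abs_le (v 0 * a), neg_abs_le (v j.succ * b)]
  refine ENNReal.toReal_le_of_le_ofReal (by positivity) ?_
  calc _ ≤ _ := measure_mono hsub
    _ ≤ _ := measure_union_le _ _
    _ ≤ ENNReal.ofReal (1 / R ^ 2) + ENNReal.ofReal (1 / R ^ 2) := add_le_add (hev _) (hev _)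
    _ = ENNReal.ofReal (2 / R ^ 2) := by
      rw [← ENNReal.ofReal_add (by positivity) (by positivity)]
      congr 1
      ring

theorem empCDF_eq_one {m : ℕ} (hm : m ≠ 0) {xs : Fin m → ℝ} {t : ℝ} (h : ∀ i, xs i ≤ t) :
    empCDF xs t = 1 := by
  simp [empCDF, h, hm]

theorem le_iSup_abs_empCDF_sub_cdfOf {𝒳 : Type*} [MeasurableSpace 𝒳] (μ : Measure 𝒳)
    [IsProbabilityMeasure μ] {ι : Type*} {A : Set ι} (g : 𝒳 → ι → ℝ) {m : ℕ}
    (ω : Fin m → 𝒳) {x : ι} (hx : x ∈ A) (t : ℝ) :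
    |empCDF (fun i => g (ω i) x) t - cdfOf μ (fun v => g v x) t| ≤
      ⨆ x ∈ A, ⨆ t : ℝ, |empCDF (fun i => g (ω i) x) t - cdfOf μ (fun v => g v x) t| := by
  have hb : ∀ x t, |empCDF (fun i => g (ω i) x) t - cdfOf μ (fun v => g v x) t| ≤ 1 := by
    intro x t
    have h1 := empCDF_nonneg (fun i => g (ω i) x) t
    have h2 := empCDF_le_one (fun i => g (ω i) x) t
    have h3 : 0 ≤ cdfOf μ (fun v => g v x) t := ENNReal.toReal_nonneg
    have h4 : cdfOf μ (fun v => g v x) t ≤ 1 := measureReal_le_one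
    exact abs_le.2 ⟨by linarith, by linarith⟩
  have hb' : ∀ x, ⨆ t : ℝ, |empCDF (fun i => g (ω i) x) t - cdfOf μ (fun v => g v x) t| ≤ 1 :=
    fun x => ciSup_le (hb x)
  refine (le_ciSup (f := fun t : ℝ =>
    |empCDF (fun i => g (ω i) x) t - cdfOf μ (fun v => g v x) t|) ⟨1, ?_⟩ t).trans ?_
  · rintro _ ⟨t, rfl⟩
    exact hb x t
  refine le_trans (le_of_eq ?_) (le_ciSup (f := fun x => ⨆ _ : x ∈ A, ⨆ t : ℝ,
    |empCDF (fun i => g (ω i) x) t - cdfOf μ (fun v => g v x) t|) ⟨1, ?_⟩ x)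
  · rw [ciSup_pos hx]
  · rintro _ ⟨y, rfl⟩
    exact Real.iSup_le (fun _ => hb' y) zero_le_one

/-- Without subexponential tail decay, a deviation level `t` violating the tail bound with
constant `L` can be taken to be at least `L`. -/
theorem exists_heavy_tail_level (ν : Measure ℝ) [IsProbabilityMeasure ν]
    (hvar : (∫ t, t ^ 2 ∂ν) = 1)
    (htail : ∀ L : ℝ, 1 ≤ L → ∃ t : ℝ, 20 < t ∧
      ENNReal.ofReal (Real.exp (-t / L)) ≤ ν (Set.Iic (-t)))
    {L : ℝ} (hL : 1 ≤ L) :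
    ∃ t : ℝ, L ≤ t ∧ ENNReal.ofReal (Real.exp (-t / L)) ≤ ν (Set.Iic (-t)) := by
  obtain ⟨t, ht, hexp⟩ := htail L hL
  refine ⟨t, ?_, hexp⟩
  by_contra! hlt
  have hsub : Set.Iic (-t) ⊆ {s : ℝ | t ≤ |s|} := fun s hs =>
    (le_neg.1 (Set.mem_Iic.1 hs)).trans (neg_le_abs s)
  have h := (hexp.trans (measure_mono hsub)).trans (measure_le_abs_le ν hvar (by linarith))
  rw [ENNReal.ofReal_le_ofReal_iff (by positivity)] at h
  have h1 : Real.exp (-1) ≤ Real.exp (-t / L) := by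
    refine Real.exp_le_exp.2 ?_
    rw [le_div_iff₀ (by linarith)]
    linarith
  have h2 : 1 / t ^ 2 ≤ 1 / 400 := one_div_le_one_div_of_le (by norm_num) (by nlinarith)
  have h3 := Real.exp_neg_one_gt_d9
  linarith

theorem one_sub_pow_le_of_le {q : ENNReal} {p : ℝ} (hp0 : 0 ≤ p) (hp1 : p ≤ 1)
    (hq : ENNReal.ofReal p ≤ q) {N : ℕ} (hN : 3 ≤ p * N) :
    (1 - q) ^ N ≤ ENNReal.ofReal (1 / 20) := by
  calc (1 - q) ^ N ≤ (1 - ENNReal.ofReal p) ^ N := by gcongr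
    _ = ENNReal.ofReal ((1 - p) ^ N) := by
      rw [← ENNReal.ofReal_one, ← ENNReal.ofReal_sub _ hp0, ENNReal.ofReal_pow (by linarith)]
    _ ≤ ENNReal.ofReal (1 / 20) := by
      refine ENNReal.ofReal_le_ofReal ?_
      have h1 : (1 - p) ^ N ≤ Real.exp (-p) ^ N :=
        pow_le_pow_left₀ (by linarith) (by linarith [Real.add_one_le_exp (-p)]) N
      rw [← Real.exp_nat_mul] at h1
      have h2 : Real.exp (N * -p) ≤ Real.exp (-3) := Real.exp_le_exp.2 (by linarith)
      have h3 : Real.exp (-3) = Real.exp (-1) ^ 3 := by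
        rw [← Real.exp_nat_mul]; norm_num
      have h4 : Real.exp (-1) ^ 3 ≤ (0.3678794412 : ℝ) ^ 3 :=
        pow_le_pow_left₀ (Real.exp_pos _).le Real.exp_neg_one_lt_d9.le 3
      norm_num at h4
      linarith

/-- **Lemma 1.12**: if the coordinate distribution `w ∼ ν` (symmetric, variance 1,
nontrivial) does not have a subexponential tail decay, then for every `m ≥ 231` there are
a dimension `d` and a set `A ⊆ S^{d-1}` with `γ₁(A) ≤ 10` on which the uniform DKW
inequality fails at level `1/10`, for the random vector `X` with iid coordinates
distributed as `w`. -/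
theorem no_subexponential_tail_obstruction (ν : Measure ℝ) [IsProbabilityMeasure ν]
    -- `w` is symmetric with variance 1 and `ℙ(|w| ≥ 0.1) ≥ 0.1`:
    (hsymm : Measure.map (fun t : ℝ => -t) ν = ν)
    (hvar : (∫ t, t ^ 2 ∂ν) = 1)
    (hnontriv : ENNReal.ofReal 0.1 ≤ ν {t : ℝ | 0.1 ≤ |t|})
    -- `w` does not have a subexponential tail decay:
    (htail : ∀ L : ℝ, 1 ≤ L → ∃ t : ℝ, 20 < t ∧
      ENNReal.ofReal (Real.exp (-t / L)) ≤ ν (Set.Iic (-t)))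
    (m : ℕ) (hm : 231 ≤ m) :
    ∃ (d : ℕ) (A : Set (Fin d → ℝ)),
      A ⊆ unitSphere d ∧ gamma1 euclDist A ≤ 10 ∧
      ENNReal.ofReal 0.9 ≤
        (Measure.pi fun _ : Fin m => (Measure.pi fun _ : Fin d => ν))
          {ω | (1 : ℝ) / 10 ≤ ⨆ x ∈ A, ⨆ t : ℝ,
            |empCDF (fun i => dotp (ω i) x) t -
              cdfOf (Measure.pi fun _ : Fin d => ν) (fun v => dotp v x) t|} := by
  have hm0 : m ≠ 0 := by omega
  have hM : (231 : ℝ) ≤ m := by exact_mod_cast hm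
  set M : ℝ := (m : ℝ) with hMdef
  have hMpos : 0 < M := by linarith
  obtain ⟨t, hLt, htν⟩ := exists_heavy_tail_level ν hvar htail
    (L := 1000 * M ^ 2) (by nlinarith)
  have htpos : 0 < t := by nlinarith
  have htM : 1000 * M ≤ t / M := by
    rw [le_div_iff₀ hMpos]; nlinarith
  obtain ⟨k, hk1, hk2⟩ := exists_nat_pow_near (x := t / (6 * M)) (y := (2 : ℝ))
    (by rw [le_div_iff₀ (by positivity)]; nlinarith) one_lt_two
  have hk : 1 ≤ k := by
    by_contra! h
    obtain rfl : k = 0 := by omega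
    rw [div_lt_iff₀ (by positivity)] at hk2
    norm_num at hk2
    nlinarith
  set N : ℕ := 2 ^ 2 ^ k with hN
  set b : ℝ := 30 * M / t with hb
  have hbpos : 0 < b := by positivity
  have hbt : b * t = 30 * M := by rw [hb]; field_simp
  have hb1 : b ≤ 1 := by
    rw [hb, div_le_one htpos]; nlinarith
  set a : ℝ := Real.sqrt (1 - b ^ 2) with ha
  have hab : a ^ 2 + b ^ 2 = 1 := by
    rw [ha, Real.sq_sqrt (by nlinarith)]; ring
  have ha0 : 0 ≤ a := Real.sqrt_nonneg _
  have ha1 : a ≤ 1 := by nlinarith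
  set A : Set (Fin (N + 1) → ℝ) := Set.range (spike N a b) with hA
  refine ⟨N + 1, A, ?_, ?_, ?_⟩
  · rintro _ ⟨j, rfl⟩
    exact spike_mem_unitSphere hab j
  · have hcard : A.ncard ≤ N := by
      rw [hA, ← Set.image_univ]
      exact (Set.ncard_image_le Set.finite_univ).trans_eq (by simp [Set.ncard_univ])
    have hNpos : 0 < N := by positivity
    refine (gamma1_euclDist_le (Set.finite_range _) ⟨_, ⟨0, hNpos⟩, rfl⟩ hk hcard
      (δ := 2 * b) ?_).trans ?_
    · rintro _ ⟨i, rfl⟩ _ ⟨j, rfl⟩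
      exact euclDist_spike_le a hbpos.le i j
    · calc (2 : ℝ) ^ k * (2 * b) ≤ t / (6 * M) * (2 * b) := by gcongr
        _ = 10 := by rw [hb]; field_simp; norm_num
  · set P := Measure.pi fun _ : Fin m => (Measure.pi fun _ : Fin (N + 1) => ν) with hP
    set E : Set (Fin m → Fin (N + 1) → ℝ) := {ω | (1 : ℝ) / 10 ≤ ⨆ x ∈ A, ⨆ t : ℝ,
            |empCDF (fun i => dotp (ω i) x) t -
              cdfOf (Measure.pi fun _ : Fin (N + 1) => ν) (fun v => dotp v x) t|} with hE
    have hcover : (Set.univ : Set (Fin m → Fin (N + 1) → ℝ)) ⊆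
        E ∪ ((⋃ i, {ω | 10 * M ≤ |ω i 0|}) ∪
          {ω | ∀ j : Fin N, ∃ i, ω i j.succ ∉ Set.Iic (-t)}) := by
      intro ω _
      by_contra hcon
      simp only [Set.mem_union, Set.mem_iUnion, not_or, Set.mem_ofPred_eq, not_exists, not_le,
        not_forall, Set.mem_Iic] at hcon
      obtain ⟨hωE, hω0, j, hj⟩ := hcon
      refine hωE ?_
      refine le_trans ?_ (le_iSup_abs_empCDF_sub_cdfOf (A := A)
        (Measure.pi fun _ : Fin (N + 1) => ν) dotp ω (Set.mem_range_self j) (-2 * (10 * M)))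
      rw [empCDF_eq_one hm0]
      · have hc := cdfOf_dotp_spike_le ν hvar (N := N) (a := a) (b := b)
          (abs_le.2 ⟨by linarith, ha1⟩) (abs_le.2 ⟨by linarith, hb1⟩)
          (show 0 < 10 * M by positivity) j
        have h2 : 2 / (10 * M) ^ 2 ≤ 1 / 10 := by
          rw [div_le_iff₀ (by positivity)]; nlinarith
        refine le_trans ?_ (le_abs_self _)
        linarith
      · intro i
        rw [dotp_spike]
        have h1 : ω i 0 * a ≤ 10 * M := by
          have := (abs_lt.1 (hω0 i)).2
          nlinarith
        have h2 : ω i j.succ * b ≤ -t * b := mul_le_mul_of_nonneg_right (not_lt.1 (hj i)) hbpos.le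
        linarith
    have hunion : P (⋃ i, {ω | 10 * M ≤ |ω i 0|}) ≤ ENNReal.ofReal (1 / 20) := by
      calc P (⋃ i, {ω | 10 * M ≤ |ω i 0|}) ≤ ∑ i : Fin m, P {ω | 10 * M ≤ |ω i 0|} := by
            simpa using measure_iUnion_le (μ := P) fun i : Fin m =>
              {ω : Fin m → Fin (N + 1) → ℝ | 10 * M ≤ |ω i 0|}
        _ ≤ ∑ _i : Fin m, ENNReal.ofReal (1 / (10 * M) ^ 2) := by
            refine Finset.sum_le_sum fun i _ => ?_
            refine le_of_eq_of_le ?_ (measure_le_abs_le ν hvar (show 0 < 10 * M by positivity))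
            exact ((measurePreserving_eval (fun _ : Fin (N + 1) => ν) 0).comp
              (measurePreserving_eval (fun _ : Fin m =>
                Measure.pi fun _ : Fin (N + 1) => ν) i)).measure_preimage
              (measurableSet_le measurable_const measurable_id.abs).nullMeasurableSet
        _ = ENNReal.ofReal (M * (1 / (10 * M) ^ 2)) := by
            rw [Finset.sum_const, Finset.card_univ, Fintype.card_fin, nsmul_eq_mul,
              ENNReal.ofReal_mul hMpos.le, hMdef, ENNReal.ofReal_natCast]
        _ ≤ ENNReal.ofReal (1 / 20) := by
            refine ENNReal.ofReal_le_ofReal ?_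
            rw [mul_one_div, div_le_iff₀ (by positivity)]
            nlinarith
    have hspike : P {ω | ∀ j : Fin N, ∃ i, ω i j.succ ∉ Set.Iic (-t)} ≤
        ENNReal.ofReal (1 / 20) := by
      rw [hP, pi_pi_forall_exists_notMem ν m N measurableSet_Iic]
      refine one_sub_pow_le_of_le (p := Real.exp (-t / (1000 * M ^ 2)) ^ m) (by positivity) ?_ ?_ ?_
      · refine pow_le_one₀ (Real.exp_pos _).le (Real.exp_le_one_iff.2 ?_)
        exact div_nonpos_of_nonpos_of_nonneg (by linarith) (by positivity)
      · rw [ENNReal.ofReal_pow (Real.exp_pos _).le]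
        gcongr
      · have h1 : Real.exp (-t / (1000 * M ^ 2)) ^ m = Real.exp (-(t / M) / 1000) := by
          rw [← Real.exp_nat_mul, ← hMdef]
          congr 1
          field_simp
        have h2 : (N : ℝ) = Real.exp (2 ^ k * Real.log 2) := by
          have h := Real.exp_nat_mul (Real.log 2) (2 ^ k)
          rw [Real.exp_log two_pos] at h
          rw [hN]
          push_cast at h ⊢
          exact h.symm
        rw [h1, h2, ← Real.exp_add]
        have h3 : t / M / 12 < 2 ^ k := by
          have : t / (6 * M) = t / M / 6 := by field_simp
          rw [this, pow_succ] at hk2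
          linarith
        have h4 := Real.log_two_gt_d9
        have h5 : t / M / 12 * (1 / 2) ≤ 2 ^ k * Real.log 2 :=
          mul_le_mul h3.le (by linarith) (by norm_num) (by positivity)
        have h6 := Real.add_one_le_exp (-(t / M) / 1000 + 2 ^ k * Real.log 2)
        linarith
    have htotal : 1 ≤ P E + ENNReal.ofReal (1 / 10) := by
      calc (1 : ENNReal) = P Set.univ := measure_univ.symm
        _ ≤ _ := measure_mono hcover
        _ ≤ _ := measure_union_le _ _
        _ ≤ P E + (ENNReal.ofReal (1 / 20) + ENNReal.ofReal (1 / 20)) :=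
          add_le_add le_rfl ((measure_union_le _ _).trans (add_le_add hunion hspike))
        _ = P E + ENNReal.ofReal (1 / 10) := by
          rw [← ENNReal.ofReal_add (by norm_num) (by norm_num)]
          norm_num
    have h09 : ENNReal.ofReal 0.9 = 1 - ENNReal.ofReal (1 / 10) := by
      rw [← ENNReal.ofReal_one, ← ENNReal.ofReal_sub _ (by norm_num)]
      norm_num
    rw [h09]
    exact tsub_le_iff_right.2 htotal
end
end
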